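/- arXiv:0912.2829 — 4 statements merged into one kernel-verified Lean document; each statement's English description precedes it below -/
import Mathlib

section
/- One has V_{pe₁s−b^{(e)}·s} = V; equivalently, V ⊆ Ū_{pe₁s−b^{(e)}·s}. -/
/-- The subgroup of `p`-th powers in `Kˣ`. -/
noncomputable def pthPowers (p : ℕ) (K : Type*) [Field K] : Subgroup Kˣ :=
  (powMonoidHom p : Kˣ →* Kˣ).range

/-- The `𝔽_p`-vector space `Kˣ/(Kˣ)ᵖ`. -/
abbrev KmodP (p : ℕ) (K : Type*) [Field K] :=
  Kˣ ⧸ pthPowers p K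

/-- For `i ≥ 1`, the image `Ū_i` of `U_i = 1 + 𝔓^i` in `Kˣ/(Kˣ)ᵖ`, where `𝔓` is the
maximal ideal of the ring of integers of `K` and `w` is the normalized valuation. -/
def UbarSet (p : ℕ) (K : Type*) [Field K] (w : K → ℤ) (i : ℤ) : Set (KmodP p K) :=
  {c | ∃ x : Kˣ, (QuotientGroup.mk x : KmodP p K) = c ∧
    ∃ u y : K, y ≠ 0 ∧ (u - 1 = 0 ∨ i ≤ w (u - 1)) ∧ (x : K) = u * y ^ p}

/-- The `ω`-eigenspace `V ⊆ Kˣ/(Kˣ)ᵖ` for the natural action of `Δ = Gal(K|F)`: the set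
of classes `x̄` with `σ(x)·x^{−ω(σ)} ∈ (Kˣ)ᵖ` for all `σ ∈ Δ`. -/
def omegaEigenspace (p : ℕ) (F K : Type*) [Field F] [Field K] [Algebra F K]
    (ω : (K ≃ₐ[F] K) → (ZMod p)ˣ) : Set (KmodP p K) :=
  {c | ∃ x : Kˣ, (QuotientGroup.mk x : KmodP p K) = c ∧
    ∀ σ : K ≃ₐ[F] K, ∃ y : K, y ≠ 0 ∧ σ (x : K) = (x : K) ^ (ω σ : ZMod p).val * y ^ p}

/-- `b^(i) = i + ⌊(i−1)/(p−1)⌋`. -/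
def bExp (p i : ℕ) : ℕ := i + (i - 1) / (p - 1)

/-- An integer-valued function on a field that is a valuation away from zero. -/
structure IsIntValuation {K : Type*} [Field K] (w : K → ℤ) : Prop where
  protected map_mul : ∀ x y : K, x ≠ 0 → y ≠ 0 → w (x * y) = w x + w y
  min_le_map_add : ∀ x y : K, x ≠ 0 → y ≠ 0 → x + y ≠ 0 → min (w x) (w y) ≤ w (x + y)

namespace IsIntValuation

variable {K : Type*} [Field K] {w : K → ℤ} (hw : IsIntValuation w)
include hw

protected lemma map_one : w 1 = 0 := by
  have h := hw.map_mul 1 1 one_ne_zero one_ne_zero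
  rw [one_mul] at h
  omega

protected lemma map_neg {x : K} (hx : x ≠ 0) : w (-x) = w x := by
  have h1 : w (-1 : K) = 0 := by
    have h := hw.map_mul (-1) (-1) (by simp) (by simp)
    rw [neg_one_mul, neg_neg, hw.map_one] at h
    omega
  have h := hw.map_mul (-1) x (by simp) hx
  rwa [neg_one_mul, h1, zero_add] at h

protected lemma map_pow {x : K} (hx : x ≠ 0) (n : ℕ) : w (x ^ n) = n * w x := by
  induction n with
  | zero => simp [hw.map_one]
  | succ n ih =>
    rw [pow_succ, hw.map_mul _ _ (pow_ne_zero _ hx) hx, ih]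
    push_cast
    ring

protected lemma map_inv {x : K} (hx : x ≠ 0) : w x⁻¹ = -w x := by
  have h := hw.map_mul x x⁻¹ hx (inv_ne_zero hx)
  rw [mul_inv_cancel₀ hx, hw.map_one] at h
  omega

protected lemma map_div {x y : K} (hx : x ≠ 0) (hy : y ≠ 0) : w (x / y) = w x - w y := by
  rw [div_eq_mul_inv, hw.map_mul _ _ hx (inv_ne_zero hy), hw.map_inv hy, sub_eq_add_neg]

/-- The elements of valuation at least `n`. -/
def level (n : ℤ) : AddSubgroup K where
  carrier := {x | x ≠ 0 → n ≤ w x}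
  zero_mem' := fun h => absurd rfl h
  add_mem' := by
    intro a b ha hb hab
    by_cases ha0 : a = 0
    · subst ha0
      rw [zero_add] at hab ⊢
      exact hb hab
    by_cases hb0 : b = 0
    · subst hb0
      rw [add_zero] at hab ⊢
      exact ha hab
    exact (le_min (ha ha0) (hb hb0)).trans (hw.min_le_map_add a b ha0 hb0 hab)
  neg_mem' := by
    intro x hx hx0
    have hx1 : x ≠ 0 := by simpa using hx0
    rw [hw.map_neg hx1]
    exact hx hx1

lemma mem_level_iff {n : ℤ} {x : K} (hx : x ≠ 0) : x ∈ hw.level n ↔ n ≤ w x :=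
  ⟨fun h => h hx, fun h _ => h⟩

lemma mem_level_self (x : K) : x ∈ hw.level (w x) := fun _ => le_rfl

lemma level_anti {m n : ℤ} (h : m ≤ n) {x : K} (hx : x ∈ hw.level n) : x ∈ hw.level m :=
  fun h0 => h.trans (hx h0)

lemma mul_mem_level {m n : ℤ} {x y : K} (hx : x ∈ hw.level m) (hy : y ∈ hw.level n) :
    x * y ∈ hw.level (m + n) := by
  intro h
  have hx0 := left_ne_zero_of_mul h
  have hy0 := right_ne_zero_of_mul h
  rw [hw.map_mul _ _ hx0 hy0]
  exact add_le_add (hx hx0) (hy hy0)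

lemma one_mem_level : (1 : K) ∈ hw.level 0 := fun _ => hw.map_one.ge

lemma natCast_mem_level (n : ℕ) : (n : K) ∈ hw.level 0 := by
  simpa using nsmul_mem hw.one_mem_level n

lemma intCast_mem_level (n : ℤ) : (n : K) ∈ hw.level 0 := by
  simpa using zsmul_mem hw.one_mem_level n

/-- An element close to a nonzero `y` is nonzero with the same valuation. -/
lemma map_eq_of_sub_mem {x y : K} (hy : y ≠ 0) (h : x - y ∈ hw.level (w y + 1)) :
    x ≠ 0 ∧ w x = w y := by
  have key : ∀ z : K, z ∈ hw.level (w y + 1) → y - z ∉ hw.level (w y + 1) := by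
    intro z hz hyz
    have := add_mem hyz hz
    rw [sub_add_cancel, hw.mem_level_iff hy] at this
    omega
  have h1 : x ∉ hw.level (w y + 1) := by
    intro hx
    apply key (-(x - y) + x) (add_mem (neg_mem h) hx)
    simp
  have hx : x ≠ 0 := by
    rintro rfl
    exact h1 (zero_mem _)
  refine ⟨hx, ?_⟩
  rw [hw.mem_level_iff hx] at h1
  have h2 : x ∈ hw.level (w y) := by
    have := add_mem (hw.level_anti (by omega) h) (hw.mem_level_self y)
    rwa [sub_add_cancel] at this
  have := h2 hx
  omega

/-- The valuation ring. -/
def valuationSubring : ValuationSubring K where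
  carrier := hw.level 0
  mul_mem' := fun ha hb => hw.mul_mem_level ha hb
  one_mem' := hw.one_mem_level
  add_mem' := fun ha hb => add_mem ha hb
  zero_mem' := zero_mem _
  neg_mem' := fun ha => neg_mem ha
  mem_or_inv_mem' := by
    intro x
    by_cases hx : x = 0
    · exact Or.inl (hx ▸ zero_mem _)
    · simp only [SetLike.mem_coe, hw.mem_level_iff hx, hw.mem_level_iff (inv_ne_zero hx),
        hw.map_inv hx]
      omega

lemma mem_valuationSubring {x : K} : x ∈ hw.valuationSubring ↔ x ∈ hw.level 0 := Iff.rfl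

lemma pow_mem_level {x : K} (hx : x ∈ hw.level 0) (n : ℕ) : x ^ n ∈ hw.level 0 :=
  pow_mem (S := hw.valuationSubring) hx n

lemma mem_maximalIdeal {x : hw.valuationSubring} :
    x ∈ IsLocalRing.maximalIdeal hw.valuationSubring ↔ (x : K) ∈ hw.level 1 := by
  rw [← ValuationSubring.coe_mem_nonunits_iff, ValuationSubring.mem_nonunits_iff_or]
  by_cases hx : (x : K) = 0
  · simp [hx, zero_mem]
  · rw [hw.mem_valuationSubring, hw.mem_level_iff hx, hw.mem_level_iff (inv_ne_zero hx),
      hw.map_inv hx]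
    simp only [hx, false_or]
    omega

lemma ne_zero_and_map_eq_zero_of_not_mem {x : K} (h0 : x ∈ hw.level 0) (h1 : x ∉ hw.level 1) :
    x ≠ 0 ∧ w x = 0 := by
  have hx : x ≠ 0 := by
    rintro rfl
    exact h1 (zero_mem _)
  rw [hw.mem_level_iff hx] at h0 h1
  exact ⟨hx, by omega⟩

/-- The expansion `(1 + a) ^ n ≡ 1 + n a` modulo `a ^ 2`. -/
lemma one_add_pow_sub_mem {a : K} {j : ℤ} (hj : 0 ≤ j) (ha : a ∈ hw.level j) (n : ℕ) :
    (1 + a) ^ n - (1 + n * a) ∈ hw.level (j + j) := by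
  induction n with
  | zero => simp [zero_mem]
  | succ n ih =>
    have h1 : (1 + a) ^ (n + 1) - (1 + (n + 1 : ℕ) * a) =
        ((1 + a) ^ n - (1 + n * a)) * (1 + a) + n * (a * a) := by
      push_cast
      ring
    rw [h1]
    refine add_mem ?_ ?_
    · simpa using hw.mul_mem_level ih (add_mem hw.one_mem_level (hw.level_anti hj ha))
    · simpa using hw.mul_mem_level (hw.natCast_mem_level n) (hw.mul_mem_level ha ha)

/-- For a prime `p`, `(1 + a) ^ p - 1 - a ^ p` is divisible by `p a`. -/
lemma one_add_pow_prime_sub_mem {p : ℕ} (hp : p.Prime) {a : K} {j : ℤ} (hj : 0 ≤ j)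
    (ha : a ∈ hw.level j) :
    (1 + a) ^ p - 1 - a ^ p ∈ hw.level (w (p : K) + j) := by
  have ha0 := hw.level_anti hj ha
  obtain ⟨r, hr⟩ := exists_add_pow_prime_eq hp (1 : hw.valuationSubring) ⟨a, ha0⟩
  have h := congrArg (Subtype.val) hr
  push_cast at h
  have h2 : (1 + a) ^ p - 1 - a ^ p = (p : K) * a * r := by
    rw [h]
    ring
  rw [h2]
  simpa using hw.mul_mem_level (hw.mul_mem_level (hw.mem_level_self (p : K)) ha) r.2

lemma map_natCast_eq_zero {p : ℕ} (hp : p.Prime) (hwp : 0 < w (p : K)) {n : ℕ} (hn : 0 < n)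
    (hnp : n < p) : (n : K) ≠ 0 ∧ w (n : K) = 0 := by
  refine hw.ne_zero_and_map_eq_zero_of_not_mem (hw.natCast_mem_level n) fun h1 => ?_
  have hc : IsCoprime (n : ℤ) (p : ℤ) :=
    Nat.isCoprime_iff_coprime.mpr
      (Nat.Coprime.symm (hp.coprime_iff_not_dvd.mpr (Nat.not_dvd_of_pos_of_lt hn hnp)))
  obtain ⟨a, b, hab⟩ := hc
  have h := congrArg (Int.cast (R := K)) hab
  push_cast at h
  have h3 := add_mem (hw.mul_mem_level (hw.intCast_mem_level a) h1)
    (hw.mul_mem_level (hw.intCast_mem_level b)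
      (hw.level_anti (m := 1) (by omega) (hw.mem_level_self (p : K))))
  rw [h, hw.mem_level_iff one_ne_zero, hw.map_one] at h3
  omega

lemma mem_level_of_pow_mem {x : K} {n : ℕ} (h : x ^ n ∈ hw.level 1) : x ∈ hw.level 1 := by
  intro hx
  rw [hw.mem_level_iff (pow_ne_zero _ hx), hw.map_pow hx] at h
  by_contra! h1
  have : w x ≤ 0 := by omega
  nlinarith [Int.natCast_nonneg n]

end IsIntValuation

section Padic

variable {p : ℕ} [Fact p.Prime] {K : Type*} [Field K] [Algebra ℚ_[p] K] {w : K → ℤ}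

/-- The structure map from the `p`-adic integers. -/
noncomputable def padicIntHom (p : ℕ) [Fact p.Prime] (K : Type*) [Field K] [Algebra ℚ_[p] K] :
    ℤ_[p] →+* K :=
  (algebraMap ℚ_[p] K).comp PadicInt.Coe.ringHom

lemma PadicInt.exists_pow_eq_one_add (z : ℤ_[p]) (m : ℕ) :
    ∃ t : ℤ_[p], t ^ (p * m + 1) = 1 + p * z := by
  have hF := hensels_lemma (p := p) (R := ℤ_[p])
    (F := Polynomial.X ^ (p * m + 1) - Polynomial.C (1 + (p : ℤ_[p]) * z)) (a := 1) ?_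
  · obtain ⟨t, ht, -⟩ := hF
    refine ⟨t, ?_⟩
    simpa [sub_eq_zero] using ht
  · have hlt : ∀ y : ℤ_[p], ‖(p : ℤ_[p]) * y‖ < 1 := fun y => by
      rw [PadicInt.norm_lt_one_iff_dvd]
      exact dvd_mul_right _ _
    have h1 : ‖(p : ℤ_[p]) * m + 1‖ = 1 := by
      rw [← PadicInt.isUnit_iff, ← IsLocalRing.notMem_maximalIdeal]
      intro h
      have h2 : (p : ℤ_[p]) * m ∈ IsLocalRing.maximalIdeal ℤ_[p] := by
        rw [PadicInt.maximalIdeal_eq_span_p, Ideal.mem_span_singleton]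
        exact dvd_mul_right _ _
      exact (IsLocalRing.maximalIdeal ℤ_[p]).ne_top_iff_one.mp
        (IsLocalRing.maximalIdeal.isMaximal _).ne_top (by simpa using sub_mem h h2)
    have h2 : ‖-((p : ℤ_[p]) * z)‖ < ‖(p : ℤ_[p]) * m + 1‖ ^ 2 := by
      rw [h1, norm_neg, one_pow]
      exact hlt z
    have h3 : (Polynomial.X ^ (p * m + 1) - Polynomial.C (1 + (p : ℤ_[p]) * z)).aeval (1 : ℤ_[p]) =
        -((p : ℤ_[p]) * z) := by
      simp
    have h4 : (Polynomial.X ^ (p * m + 1) -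
        Polynomial.C (1 + (p : ℤ_[p]) * z)).derivative.aeval (1 : ℤ_[p]) =
        (p : ℤ_[p]) * m + 1 := by
      rw [Polynomial.derivative_sub, Polynomial.derivative_X_pow, Polynomial.derivative_C]
      simp
    rwa [h3, h4]

namespace IsIntValuation

variable (hw : IsIntValuation w)
include hw

lemma padicInt_mem_level (hwp : 0 < w (p : K)) (z : ℤ_[p]) : padicIntHom p K z ∈ hw.level 0 := by
  have hp0 : (p : K) ≠ 0 := by
    have := charZero_of_injective_algebraMap (R := ℚ_[p]) (algebraMap ℚ_[p] K).injective
    exact_mod_cast (Fact.out : p.Prime).ne_zero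
  have h1 : ∀ z : ℤ_[p], 1 + (p : K) * padicIntHom p K z ∈ hw.level 0 := by
    intro z h0
    by_contra! hneg
    obtain ⟨t, ht⟩ := PadicInt.exists_pow_eq_one_add z (w (1 + (p : K) * padicIntHom p K z)).natAbs
    have ht' := congrArg (padicIntHom p K) ht
    simp only [map_pow, map_add, map_one, map_mul, map_natCast] at ht'
    have ht0 : padicIntHom p K t ≠ 0 := by
      intro h
      rw [h, zero_pow (by simp)] at ht'
      exact h0 ht'.symm
    have h3 := hw.map_pow ht0 (p * (w (1 + (p : K) * padicIntHom p K z)).natAbs + 1)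
    rw [ht'] at h3
    set m := w (1 + (p : K) * padicIntHom p K z)
    push_cast at h3
    have hpm : 1 ≤ (p : ℤ) := by exact_mod_cast (Fact.out : p.Prime).one_lt.le
    have h4 : |m| = -m := abs_of_neg hneg
    rw [h4] at h3
    rcases lt_or_ge (w (padicIntHom p K t)) 0 with h | h
    · nlinarith [mul_le_mul_of_nonneg_right hpm (show 0 ≤ -m by omega)]
    · nlinarith [mul_nonneg (show (0:ℤ) ≤ p * -m + 1 by nlinarith) h]
  have h2 : ∀ z : ℤ_[p], padicIntHom p K z ≠ 0 → -w (p : K) ≤ w (padicIntHom p K z) := by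
    intro z hz
    have := sub_mem (h1 z) hw.one_mem_level
    rw [add_sub_cancel_left, hw.mem_level_iff (mul_ne_zero hp0 hz), hw.map_mul _ _ hp0 hz] at this
    omega
  intro hz
  by_contra! hneg
  have h3 := h2 (z ^ ((w (p : K)).toNat + 1)) (by rw [map_pow]; exact pow_ne_zero _ hz)
  rw [map_pow, hw.map_pow hz] at h3
  push_cast at h3
  rw [Int.toNat_of_nonneg hwp.le] at h3
  nlinarith

/-- The structure map from the `p`-adic integers to the valuation ring. -/
noncomputable def padicIntToSubring (hwp : 0 < w (p : K)) : ℤ_[p] →+* hw.valuationSubring :=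
  (padicIntHom p K).codRestrict hw.valuationSubring (hw.padicInt_mem_level hwp)

end IsIntValuation

lemma exists_monic_of_spectralNorm_le_one [FiniteDimensional ℚ_[p] K] {x : K}
    (hx : spectralNorm ℚ_[p] K x ≤ 1) :
    ∃ P : Polynomial ℤ_[p], P.Monic ∧ P.eval₂ (padicIntHom p K) x = 0 := by
  have hm := minpoly.monic (Algebra.IsIntegral.isIntegral (R := ℚ_[p]) x)
  have hc := (spectralValue_le_one_iff hm).mp hx
  have hl : minpoly ℚ_[p] x ∈ Polynomial.lifts (PadicInt.Coe.ringHom (p := p)) := by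
    rw [Polynomial.lifts_iff_coeff_lifts]
    exact fun n => ⟨⟨_, hc n⟩, rfl⟩
  obtain ⟨P, hP, -, hPm⟩ := Polynomial.lifts_and_degree_eq_and_monic hl hm
  refine ⟨P, hPm, ?_⟩
  rw [padicIntHom, ← Polynomial.eval₂_map, hP]
  exact minpoly.aeval _ x

namespace IsIntValuation

variable (hw : IsIntValuation w) [FiniteDimensional ℚ_[p] K]
include hw

lemma mem_level_of_spectralNorm_le_one (hwp : 0 < w (p : K)) {x : K}
    (hx : spectralNorm ℚ_[p] K x ≤ 1) : x ∈ hw.level 0 := by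
  obtain ⟨P, hPm, hP⟩ := exists_monic_of_spectralNorm_le_one hx
  have hi : IsIntegral hw.valuationSubring x := by
    refine ⟨P.map (hw.padicIntToSubring hwp), hPm.map _, ?_⟩
    rw [Polynomial.eval₂_map]
    exact hP
  obtain ⟨y, hy⟩ := IsIntegrallyClosed.isIntegral_iff.mp hi
  rw [← hy]
  exact y.2

lemma map_algEquiv (hwp : 0 < w (p : K)) (σ : K ≃ₐ[ℚ_[p]] K) (x : K) : w (σ x) = w x := by
  by_cases hx : x = 0
  · rw [hx, map_zero]
  have hσx : σ x ≠ 0 := by simpa using hx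
  have hdiv : ∀ y z : K, z ≠ 0 → spectralNorm ℚ_[p] K y = spectralNorm ℚ_[p] K z →
      spectralNorm ℚ_[p] K (y / z) ≤ 1 := by
    intro y z hz h
    have h1 := map_mul (spectralMulAlgNorm ℚ_[p] K) (y / z) z
    simp only [spectralMulAlgNorm_def, div_mul_cancel₀ _ hz] at h1
    have h2 := spectralNorm_zero_lt hz (Algebra.IsAlgebraic.isAlgebraic (R := ℚ_[p]) z)
    rw [h] at h1
    nlinarith
  have h := spectralNorm_eq_of_equiv σ x
  have h1 := hw.mem_level_of_spectralNorm_le_one hwp (hdiv _ _ hx h.symm)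
  have h2 := hw.mem_level_of_spectralNorm_le_one hwp (hdiv _ _ hσx h)
  rw [hw.mem_level_iff (div_ne_zero hσx hx), hw.map_div hσx hx] at h1
  rw [hw.mem_level_iff (div_ne_zero hx hσx), hw.map_div hx hσx] at h2
  omega

lemma spectralNorm_le_one_of_mem_level (hwp : 0 < w (p : K)) {x : K} (hx : x ∈ hw.level 0) :
    spectralNorm ℚ_[p] K x ≤ 1 := by
  by_contra! h
  have hmul : ∀ a b : K, spectralNorm ℚ_[p] K (a * b) =
      spectralNorm ℚ_[p] K a * spectralNorm ℚ_[p] K b :=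
    map_mul (spectralMulAlgNorm ℚ_[p] K)
  have hx0 : x ≠ 0 := by
    rintro rfl
    rw [spectralNorm_zero] at h
    linarith
  have hp0 : (p : K) ≠ 0 := by
    have := charZero_of_injective_algebraMap (R := ℚ_[p]) (algebraMap ℚ_[p] K).injective
    exact_mod_cast (Fact.out : p.Prime).ne_zero
  have hpow : ∀ n : ℕ, spectralNorm ℚ_[p] K (x ^ n) = spectralNorm ℚ_[p] K x ^ n :=
    map_pow (spectralMulAlgNorm ℚ_[p] K) x
  obtain ⟨n, hn⟩ := pow_unbounded_of_one_lt (p : ℝ) h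
  have hnp : spectralNorm ℚ_[p] K (p : K) = (p : ℝ)⁻¹ := by
    have h1 := spectralNorm_extends (L := K) (p : ℚ_[p])
    rwa [map_natCast, Padic.norm_p] at h1
  have hpx : (p : K) * x ^ n ≠ 0 := mul_ne_zero hp0 (pow_ne_zero _ hx0)
  have hppos : (0 : ℝ) < p := by exact_mod_cast (Fact.out : p.Prime).pos
  have h1 : 1 ≤ spectralNorm ℚ_[p] K (p * x ^ n) := by
    rw [hmul, hpow, hnp, inv_mul_eq_div, le_div_iff₀ hppos, one_mul]
    exact hn.le
  have h2 : spectralNorm ℚ_[p] K (p * x ^ n)⁻¹ ≤ 1 := by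
    have h3 := hmul (p * x ^ n)⁻¹ (p * x ^ n)
    rw [inv_mul_cancel₀ hpx, spectralNorm_one] at h3
    have := spectralNorm_nonneg (K := ℚ_[p]) ((p * x ^ n)⁻¹ : K)
    nlinarith
  have h4 := hw.mem_level_of_spectralNorm_le_one hwp h2
  rw [hw.mem_level_iff (inv_ne_zero hpx), hw.map_inv hpx, hw.map_mul _ _ hp0 (pow_ne_zero _ hx0),
    hw.map_pow hx0] at h4
  have := mul_nonneg (Int.natCast_nonneg n) (hx hx0)
  omega

/-- The residue field is perfect. -/
lemma exists_sub_pow_mem (hwp : 0 < w (p : K)) {x : K} (hx : x ∈ hw.level 0) :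
    ∃ y ∈ hw.level 0, x - y ^ p ∈ hw.level 1 := by
  rw [← hw.mem_valuationSubring] at hx
  let κ := IsLocalRing.ResidueField hw.valuationSubring
  let r : hw.valuationSubring →+* κ := IsLocalRing.residue _
  have hrp : (p : κ) = 0 := by
    rw [← map_natCast r, IsLocalRing.residue_eq_zero_iff, hw.mem_maximalIdeal]
    have := hw.level_anti (m := 1) (by omega) (hw.mem_level_self (p : K))
    simpa using this
  have : CharP κ p := (CharP.charP_iff_prime_eq_zero Fact.out).mpr hrp
  let _ : Algebra (ZMod p) κ := ZMod.algebra κ p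
  have hfac : r.comp (hw.padicIntToSubring hwp) = (algebraMap (ZMod p) κ).comp PadicInt.toZMod := by
    ext z
    have hz : z - (PadicInt.toZMod z).val ∈ IsLocalRing.maximalIdeal ℤ_[p] := by
      rw [← PadicInt.ker_toZMod, RingHom.mem_ker, map_sub, map_natCast, ZMod.natCast_zmod_val,
        sub_self]
    rw [PadicInt.maximalIdeal_eq_span_p, Ideal.mem_span_singleton] at hz
    obtain ⟨c, hc⟩ := hz
    have h1 := congrArg (r.comp (hw.padicIntToSubring hwp)) hc
    rw [map_sub, map_mul, map_natCast, map_natCast, hrp, zero_mul, sub_eq_zero] at h1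
    rw [h1, RingHom.comp_apply]
    conv_rhs => rw [← ZMod.natCast_zmod_val (PadicInt.toZMod z)]
    rw [map_natCast]
  have hint : Algebra.IsAlgebraic (ZMod p) κ := by
    refine ⟨fun a => ?_⟩
    obtain ⟨b, rfl⟩ := IsLocalRing.residue_surjective a
    obtain ⟨P, hPm, hP⟩ :=
      exists_monic_of_spectralNorm_le_one (hw.spectralNorm_le_one_of_mem_level hwp b.2)
    refine IsIntegral.isAlgebraic ⟨P.map PadicInt.toZMod, hPm.map _, ?_⟩
    rw [Polynomial.eval₂_map, ← hfac]
    have h0 : P.eval₂ (hw.padicIntToSubring hwp) b = 0 := by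
      apply Subtype.val_injective
      have := Polynomial.hom_eval₂ P (hw.padicIntToSubring hwp) hw.valuationSubring.subtype b
      exact this.trans hP
    rw [← Polynomial.hom_eval₂, h0, map_zero]
  have : PerfectField κ := Algebra.IsAlgebraic.perfectField (ZMod p)
  have : PerfectRing κ p := PerfectField.toPerfectRing p
  obtain ⟨y', hy'⟩ := (PerfectRing.bijective_frobenius (R := κ) (p := p)).2 (r ⟨x, hx⟩)
  obtain ⟨y, rfl⟩ := IsLocalRing.residue_surjective y'
  refine ⟨y, y.2, ?_⟩
  have h : (⟨x, hx⟩ - y ^ p : hw.valuationSubring) ∈ IsLocalRing.maximalIdeal _ := by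
    rw [← IsLocalRing.residue_eq_zero_iff, map_sub, map_pow, sub_eq_zero]
    exact hy'.symm
  exact hw.mem_maximalIdeal.mp h

end IsIntValuation
end Padic

namespace IsIntValuation

section Field

variable {K : Type*} [Field K] {w : K → ℤ} (hw : IsIntValuation w)
include hw

protected lemma map_zpow {x : K} (hx : x ≠ 0) (k : ℤ) : w (x ^ k) = k * w x := by
  obtain ⟨n, rfl | rfl⟩ := k.eq_nat_or_neg
  · rw [zpow_natCast, hw.map_pow hx]
  · rw [zpow_neg, zpow_natCast, hw.map_inv (pow_ne_zero _ hx), hw.map_pow hx, neg_mul]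

lemma prod_mem_level {ι : Type*} (t : Finset ι) (g : ι → K) {l : ℤ}
    (h : ∀ i ∈ t, g i ∈ hw.level l) : ∏ i ∈ t, g i ∈ hw.level (t.card * l) := by
  classical
  induction t using Finset.induction_on with
  | empty => simpa using hw.one_mem_level
  | insert a t ha ih =>
    rw [Finset.prod_insert ha, Finset.card_insert_of_notMem ha]
    have h1 := hw.mul_mem_level (h a (Finset.mem_insert_self _ _))
      (ih fun i hi => h i (Finset.mem_insert_of_mem hi))
    convert h1 using 2
    push_cast
    ring

/-- The valuation of `ζ - 1` for a primitive `p`-th root of unity `ζ`. -/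
lemma map_sub_one_of_isPrimitiveRoot {p : ℕ} (hp : p.Prime) (hp0 : (p : K) ≠ 0)
    (hwp : 0 < w (p : K)) {ζ : K} (hζ : IsPrimitiveRoot ζ p) :
    0 < w (ζ - 1) ∧ ((p - 1 : ℕ) : ℤ) * w (ζ - 1) = w (p : K) := by
  have hl0 : ζ - 1 ≠ 0 := sub_ne_zero.mpr (hζ.ne_one hp.one_lt)
  have hζ0 : ζ ≠ 0 := hζ.ne_zero hp.ne_zero
  have hppos : (0 : ℤ) < p := by exact_mod_cast hp.pos
  have hwζ : w ζ = 0 := by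
    have h := hw.map_pow hζ0 p
    rw [hζ.pow_eq_one, hw.map_one] at h
    exact (mul_eq_zero.mp h.symm).resolve_left hppos.ne'
  have hl : 0 ≤ w (ζ - 1) :=
    (sub_mem (hw.level_anti hwζ.ge (hw.mem_level_self ζ)) hw.one_mem_level) hl0
  have h1 := hw.one_add_pow_prime_sub_mem hp hl (hw.mem_level_self (ζ - 1))
  rw [add_sub_cancel, hζ.pow_eq_one, sub_self, zero_sub, neg_mem_iff,
    hw.mem_level_iff (pow_ne_zero _ hl0), hw.map_pow hl0] at h1
  have hpred : ((p - 1 : ℕ) : ℤ) = p - 1 := by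
    have := hp.one_lt
    omega
  have hprod : ((p : K)) = ∏ μ ∈ primitiveRoots p K, (1 - μ) := by
    have := Fact.mk hp
    have h2 := Polynomial.eval_one_cyclotomic_prime (R := K) (p := p)
    rw [Polynomial.cyclotomic_eq_prod_X_sub_primitiveRoots hζ, Polynomial.eval_prod] at h2
    simpa using h2.symm
  have h2 : (p : K) ∈ hw.level (((p - 1 : ℕ) : ℤ) * w (ζ - 1)) := by
    rw [hprod, ← Nat.totient_prime hp, ← hζ.card_primitiveRoots]
    refine hw.prod_mem_level _ _ fun μ hμ => ?_
    have : NeZero p := ⟨hp.ne_zero⟩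
    obtain ⟨k, -, rfl⟩ :=
      hζ.eq_pow_of_pow_eq_one ((mem_primitiveRoots hp.pos).mp hμ).pow_eq_one
    have h3 := hw.one_add_pow_sub_mem hl (hw.mem_level_self (ζ - 1)) k
    have h4 := hw.mul_mem_level (hw.natCast_mem_level k) (hw.mem_level_self (ζ - 1))
    rw [zero_add] at h4
    have h5 := neg_mem (add_mem (hw.level_anti (by omega) h3) h4)
    convert h5 using 1
    ring
  have h3 := h2 hp0
  rw [hpred] at h3 ⊢
  refine ⟨by nlinarith, by nlinarith⟩

/-- If `y ^ p` is a principal unit, then it is close to `1`. -/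
lemma pow_prime_sub_one_mem {p : ℕ} (hp : p.Prime) (hwp : 0 < w (p : K)) {y : K} {m : ℤ}
    (hy : y ∈ hw.level 0) (h : y ^ p - 1 ∈ hw.level 1) (hmp : m ≤ p) (hmw : m ≤ w (p : K) + 1) :
    y ^ p - 1 ∈ hw.level m := by
  have h1 := hw.one_add_pow_prime_sub_mem hp le_rfl (sub_mem hy hw.one_mem_level)
  rw [add_sub_cancel] at h1
  have h2 : (y - 1) ^ p ∈ hw.level 1 := by
    have := sub_mem h (hw.level_anti (m := 1) (by omega) h1)
    rwa [sub_sub_cancel] at this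
  have h3 := hw.mem_level_of_pow_mem h2
  have h4 := hw.one_add_pow_prime_sub_mem hp zero_le_one h3
  rw [add_sub_cancel] at h4
  have h5 : (y - 1) ^ p ∈ hw.level p := by
    have := hw.prod_mem_level (Finset.range p) (fun _ => y - 1) fun _ _ => h3
    simpa using this
  have := add_mem (hw.level_anti hmw h4) (hw.level_anti hmp h5)
  rwa [sub_add_cancel] at this

/-- The leading term of a principal unit lying in an eigenspace modulo `p`-th powers. -/
lemma map_sub_mul_mem {p : ℕ} (hp : p.Prime) (hwp : 0 < w (p : K)) {τ : K →+* K}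
    (hτ : ∀ x, w (τ x) = w x) {c : ℕ} {a y : K} (ha : 1 ≤ w a) (hap : w a < p)
    (haw : w a ≤ w (p : K)) (hy0 : y ≠ 0) (h : τ (1 + a) = (1 + a) ^ c * y ^ p) :
    τ a - c * a ∈ hw.level (w a + 1) := by
  have hppos : (0 : ℤ) < p := by exact_mod_cast hp.pos
  have hu : 1 + a ≠ 0 ∧ w (1 + a) = 0 := by
    have := hw.map_eq_of_sub_mem (x := 1 + a) one_ne_zero (by
      rw [add_sub_cancel_left, hw.map_one]
      exact hw.level_anti ha (hw.mem_level_self a))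
    rwa [hw.map_one] at this
  have hwy : w y = 0 := by
    have h1 := congrArg w h
    rw [hτ, hw.map_mul _ _ (pow_ne_zero _ hu.1) (pow_ne_zero _ hy0), hw.map_pow hu.1,
      hw.map_pow hy0, hu.2, mul_zero, zero_add] at h1
    exact (mul_eq_zero.mp h1.symm).resolve_left hppos.ne'
  have hy : y ∈ hw.level 0 := hw.level_anti hwy.ge (hw.mem_level_self y)
  have hua : (1 + a) ^ c - (1 + c * a) ∈ hw.level (w a + 1) :=
    hw.level_anti (by omega) (hw.one_add_pow_sub_mem (by omega) (hw.mem_level_self a) c)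
  have hca : (c : K) * a ∈ hw.level (w a) := by
    simpa using hw.mul_mem_level (hw.natCast_mem_level c) (hw.mem_level_self a)
  have hτa : τ a ∈ hw.level (w a) := hw.level_anti (hτ a).ge (hw.mem_level_self _)
  rw [map_add, map_one] at h
  have hyp : y ^ p ∈ hw.level 0 := hw.pow_mem_level hy p
  have hu1 : (1 + a) ^ c - 1 ∈ hw.level 1 := by
    have := hw.level_anti ha (add_mem (hw.level_anti (by omega) hua) hca)
    convert this using 1
    ring
  have hy1 : y ^ p - 1 ∈ hw.level 1 := by
    have h1 := hw.mul_mem_level hu1 hyp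
    have h2 := sub_mem (hw.level_anti ha hτa) h1
    convert h2 using 1
    linear_combination -h
  have hy2 := hw.pow_prime_sub_one_mem hp hwp (m := w a + 1) hy hy1 (by omega) (by omega)
  have h3 := add_mem (hw.mul_mem_level (hw.pow_mem_level
    (hw.level_anti hu.2.ge (hw.mem_level_self _)) c) hy2) (by rwa [← zero_add (w a + 1)] at hua)
  rw [zero_add] at h3
  convert h3 using 1
  linear_combination h

/-- If `a` and `b` transform in the same way to leading order, then `a / b` is fixed to leading
order. -/
lemma map_div_sub_mem {τ : K →+* K} (hτ : ∀ x, w (τ x) = w x) {c a b : K} (ha0 : a ≠ 0)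
    (hb0 : b ≠ 0) (ha : τ a - c * a ∈ hw.level (w a + 1))
    (hb : τ b - c * b ∈ hw.level (w b + 1)) : τ (a / b) - a / b ∈ hw.level (w (a / b) + 1) := by
  have hτb : τ b ≠ 0 := by simpa using hb0
  have h1 := sub_mem (hw.mul_mem_level ha (hw.mem_level_self b))
    (hw.level_anti (m := w a + 1 + w b) (by omega) (hw.mul_mem_level (hw.mem_level_self a) hb))
  have h2 := hw.mul_mem_level h1 (hw.mem_level_self (b * τ b)⁻¹)
  rw [hw.map_inv (mul_ne_zero hb0 hτb), hw.map_mul _ _ hb0 hτb, hτ] at h2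
  rw [hw.map_div ha0 hb0, map_div₀]
  convert h2 using 1
  · congr 1
    ring
  · field_simp
    ring

end Field

section Galois

variable {F K : Type*} [Field F] [Field K] [Algebra F K] [FiniteDimensional F K] [IsGalois F K]
  {w : K → ℤ} (hw : IsIntValuation w) {s : ℕ} (hsdvd : ∀ z : F, z ≠ 0 → (s : ℤ) ∣ w (algebraMap F K z))
include hw hsdvd

lemma dvd_card_mul (hσ : ∀ (σ : K ≃ₐ[F] K) (x : K), w (σ x) = w x) (x : K) (hx : x ≠ 0) : (s : ℤ) ∣ Fintype.card (K ≃ₐ[F] K) * w x := by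
  have h : ∀ t : Finset (K ≃ₐ[F] K), w (∏ σ ∈ t, σ x) = t.card * w x := by
    classical
    intro t
    induction t using Finset.induction_on with
    | empty => simp [hw.map_one]
    | insert a t ha ih =>
      rw [Finset.prod_insert ha, hw.map_mul _ _ (by simpa using hx)
        (Finset.prod_ne_zero_iff.mpr fun σ _ => by simpa using hx), ih, hσ,
        Finset.card_insert_of_notMem ha]
      push_cast
      ring
  have h1 := hsdvd (Algebra.norm F x) (Algebra.norm_ne_zero_iff.mpr hx)
  rwa [Algebra.norm_eq_prod_automorphisms, h] at h1

/-- An element fixed to leading order has the valuation of its trace. -/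
lemma dvd_of_map_sub_mem (hcard : w (Fintype.card (K ≃ₐ[F] K) : K) = 0)
    (hcard0 : (Fintype.card (K ≃ₐ[F] K) : K) ≠ 0) {b : K} (hb : b ≠ 0)
    (h : ∀ σ : K ≃ₐ[F] K, σ b - b ∈ hw.level (w b + 1)) : (s : ℤ) ∣ w b := by
  have hnb : w ((Fintype.card (K ≃ₐ[F] K) : K) * b) = w b := by
    rw [hw.map_mul _ _ hcard0 hb, hcard, zero_add]
  have h1 : algebraMap F K (Algebra.trace F K b) - (Fintype.card (K ≃ₐ[F] K) : K) * b ∈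
      hw.level (w ((Fintype.card (K ≃ₐ[F] K) : K) * b) + 1) := by
    rw [hnb, trace_eq_sum_automorphisms]
    have := sum_mem (t := Finset.univ) fun σ _ => h σ
    simpa [Finset.sum_sub_distrib] using this
  obtain ⟨h2, h3⟩ := hw.map_eq_of_sub_mem (mul_ne_zero hcard0 hb) h1
  rw [← hnb, ← h3]
  exact hsdvd _ (by simpa using h2)

end Galois

end IsIntValuation

lemma algebraAdjoin_eq_top {p : ℕ} [NeZero p] {F K : Type*} [Field F] [Field K]
    [Algebra F K] {ζ : K} (hζ : IsPrimitiveRoot ζ p)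
    (h : IntermediateField.adjoin F {ζ} = ⊤) : Algebra.adjoin F {ζ} = ⊤ := by
  have hint : IsIntegral F ζ := (hζ.isIntegral (NeZero.pos p)).tower_top
  rw [← IntermediateField.adjoin_simple_toSubalgebra_of_isAlgebraic hint.isAlgebraic, h,
    IntermediateField.top_toSubalgebra]

lemma isCyclotomicExtension_of_adjoin_eq_top {p : ℕ} [NeZero p] {F K : Type*} [Field F] [Field K]
    [Algebra F K] {ζ : K} (hζ : IsPrimitiveRoot ζ p)
    (h : IntermediateField.adjoin F {ζ} = ⊤) : IsCyclotomicExtension {p} F K := by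
  have h1 := algebraAdjoin_eq_top hζ h
  refine ⟨?_, fun x => ?_⟩
  · rintro n rfl -
    exact ⟨ζ, hζ⟩
  · have hx : x ∈ Algebra.adjoin F {ζ} := h1 ▸ Algebra.mem_top
    refine Algebra.adjoin_mono ?_ hx
    rintro _ rfl
    exact ⟨p, rfl, NeZero.ne p, hζ.pow_eq_one⟩

lemma card_algEquiv_lt {p : ℕ} [Fact p.Prime] {F K : Type*} [Field F] [Field K] [Algebra F K]
    [FiniteDimensional F K] {ζ : K} (hζ : IsPrimitiveRoot ζ p)
    (h : IntermediateField.adjoin F {ζ} = ⊤) (ω : (K ≃ₐ[F] K) → (ZMod p)ˣ)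
    (hω : ∀ σ : K ≃ₐ[F] K, σ ζ = ζ ^ (ω σ : ZMod p).val) : Fintype.card (K ≃ₐ[F] K) < p := by
  have hinj : Function.Injective ω := by
    intro σ τ hst
    have : (σ : K →ₐ[F] K) = τ := by
      refine AlgHom.ext_of_adjoin_eq_top (algebraAdjoin_eq_top hζ h) ?_
      rintro _ rfl
      simp [hω, hst]
    ext x
    exact DFunLike.congr_fun this x
  have h1 := Fintype.card_le_of_injective ω hinj
  rw [ZMod.card_units_eq_totient, Nat.totient_prime Fact.out] at h1
  have := (Fact.out : p.Prime).pos
  omega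

/-- `V_{pe₁s−b^(e)·s} = V`; equivalently `V ⊆ Ū_{pe₁s−b^(e)·s}`, where `V_i = V ∩ Ū_i`. -/
theorem statement11 (p : ℕ) [hp : Fact p.Prime] (hodd : Odd p)
    (F : Type*) [Field F] [Algebra ℚ_[p] F] [FiniteDimensional ℚ_[p] F]
    (hreg : ¬ ∃ z : F, IsPrimitiveRoot z p)
    (K : Type*) [Field K] [Algebra F K]
    (ζ : K) (hζ : IsPrimitiveRoot ζ p)
    (hKgen : IntermediateField.adjoin F {ζ} = ⊤)
    (ω : (K ≃ₐ[F] K) → (ZMod p)ˣ)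
    (hω : ∀ σ : K ≃ₐ[F] K, σ ζ = ζ ^ (ω σ : ZMod p).val)
    (w : K → ℤ) (hw0 : w 0 = 0)
    (hwmul : ∀ x y : K, x ≠ 0 → y ≠ 0 → w (x * y) = w x + w y)
    (hwadd : ∀ x y : K, x ≠ 0 → y ≠ 0 → x + y ≠ 0 → min (w x) (w y) ≤ w (x + y))
    (hwsurj : ∃ π : K, π ≠ 0 ∧ w π = 1)
    (s : ℕ) (hs : 0 < s)
    (hsdvd : ∀ z : F, z ≠ 0 → (s : ℤ) ∣ w (algebraMap F K z))
    (hsval : ∃ z : F, z ≠ 0 ∧ w (algebraMap F K z) = (s : ℤ))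
    (e : ℕ) (he : 0 < e) (hew : w (algebraMap F K (p : F)) = (e * s : ℕ))
    (f : ℕ) (hf : 0 < f) (hef : e * f = Module.finrank ℚ_[p] F)
    (e1s : ℕ) (he1s : (p - 1) * e1s = e * s)
    :
    omegaEigenspace p F K ω ∩
        UbarSet p K w (((p * e1s : ℕ) : ℤ) - bExp p e * s) =
      omegaEigenspace p F K ω := by
  have hw : IsIntValuation w := ⟨hwmul, hwadd⟩
  have hpp : p.Prime := hp.out
  let _ : Algebra ℚ_[p] K := ((algebraMap F K).comp (algebraMap ℚ_[p] F)).toAlgebra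
  have : IsScalarTower ℚ_[p] F K := IsScalarTower.of_algebraMap_eq fun _ => rfl
  have hcyc : IsCyclotomicExtension {p} F K := isCyclotomicExtension_of_adjoin_eq_top hζ hKgen
  have : CharZero F := charZero_of_injective_algebraMap (R := ℚ_[p]) (algebraMap ℚ_[p] F).injective
  have : CharZero K := charZero_of_injective_algebraMap (R := F) (algebraMap F K).injective
  have : FiniteDimensional F K := IsCyclotomicExtension.finiteDimensional {p} F K
  have : IsGalois F K := IsCyclotomicExtension.isGalois {p} F K
  have : FiniteDimensional ℚ_[p] K := FiniteDimensional.trans ℚ_[p] F K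
  have hp0 : (p : K) ≠ 0 := by exact_mod_cast hpp.ne_zero
  rw [map_natCast] at hew
  have hwp : 0 < w (p : K) := by
    rw [hew]
    exact_mod_cast Nat.mul_pos he hs
  have hσ : ∀ (σ : K ≃ₐ[F] K) (x : K), w (σ x) = w x := fun σ x =>
    hw.map_algEquiv hwp (σ.restrictScalars ℚ_[p]) x
  have hcardlt := card_algEquiv_lt hζ hKgen ω hω
  obtain ⟨π, hπ0, hπ⟩ := hwsurj
  have hscard : s ≤ Fintype.card (K ≃ₐ[F] K) := by
    have h := hw.dvd_card_mul hsdvd hσ π hπ0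
    rw [hπ, mul_one] at h
    exact Nat.le_of_dvd Fintype.card_pos (by exact_mod_cast h)
  obtain ⟨hcard0, hcardw⟩ := hw.map_natCast_eq_zero hpp hwp Fintype.card_pos hcardlt
  obtain ⟨hlpos, hl⟩ := hw.map_sub_one_of_isPrimitiveRoot hpp hp0 hwp hζ
  have hl0 : ζ - 1 ≠ 0 := sub_ne_zero.mpr (hζ.ne_one hpp.one_lt)
  have hlam : w (ζ - 1) = e1s := by
    rw [hew, ← he1s] at hl
    push_cast at hl
    have hpos : (0 : ℤ) < ((p - 1 : ℕ) : ℤ) := by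
      have := hpp.one_lt
      omega
    exact mul_left_cancel₀ hpos.ne' hl
  have hζσ : ∀ σ : K ≃ₐ[F] K, σ (ζ - 1) - ((ω σ : ZMod p).val : K) * (ζ - 1) ∈
      hw.level (w (ζ - 1) + 1) := by
    intro σ
    have h := hw.one_add_pow_sub_mem hlpos.le (hw.mem_level_self (ζ - 1)) (ω σ : ZMod p).val
    have h1 := hw.level_anti (m := w (ζ - 1) + 1) (by omega) h
    rw [add_sub_cancel, ← hω] at h1
    convert h1 using 1
    rw [map_sub, map_one]
    ring
  refine Set.inter_eq_left.mpr ?_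
  rintro _ ⟨x, rfl, hx⟩
  refine ⟨x, rfl, ?_⟩
  have hx0 : (x : K) ≠ 0 := x.ne_zero
  have hdvd : (p : ℤ) ∣ w x := by
    obtain ⟨σ, hσζ⟩ : ∃ σ : K ≃ₐ[F] K, σ ζ ≠ ζ := by
      by_contra! h
      obtain ⟨z, hz⟩ := IntermediateField.mem_bot.mp ((IsGalois.mem_bot_iff_fixed ζ).mpr h)
      rw [← hz] at hζ
      exact hreg ⟨z, hζ.of_map_of_injective (algebraMap F K).injective⟩
    obtain ⟨y, hy0, hy⟩ := hx σ
    have h1 := congrArg w hy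
    rw [hσ, hw.map_mul _ _ (pow_ne_zero _ hx0) (pow_ne_zero _ hy0), hw.map_pow hx0,
      hw.map_pow hy0] at h1
    have h2 : (p : ℤ) ∣ (((ω σ : ZMod p).val : ℤ) - 1) * w x := ⟨-w y, by linarith⟩
    refine ((Nat.prime_iff_prime_int.mp hpp).dvd_or_dvd h2).resolve_left fun h3 => hσζ ?_
    have h4 : ((((ω σ : ZMod p).val : ℤ) - 1 : ℤ) : ZMod p) = 0 :=
      (ZMod.intCast_zmod_eq_zero_iff_dvd _ p).mpr h3
    push_cast at h4
    rw [ZMod.natCast_zmod_val, sub_eq_zero] at h4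
    have : Fact (1 < p) := ⟨hpp.one_lt⟩
    rw [hω, h4, ZMod.val_one, pow_one]
  obtain ⟨k, hk⟩ := hdvd
  have hπk : π ^ k ≠ 0 := zpow_ne_zero _ hπ0
  have hx'0 : (x : K) / (π ^ k) ^ p ≠ 0 := div_ne_zero hx0 (pow_ne_zero _ hπk)
  have hx' : w ((x : K) / (π ^ k) ^ p) = 0 := by
    rw [hw.map_div hx0 (pow_ne_zero _ hπk), hw.map_pow hπk, hw.map_zpow hπ0, hπ, hk]
    ring
  obtain ⟨t, -, htx⟩ := hw.exists_sub_pow_mem hwp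
    (hw.level_anti hx'.ge (hw.mem_level_self ((x : K) / (π ^ k) ^ p)))
  have htp : t ^ p ≠ 0 ∧ w (t ^ p) = 0 := by
    have h := hw.map_eq_of_sub_mem (x := t ^ p) hx'0 (by
      rw [hx', ← neg_mem_iff, neg_sub]
      exact htx)
    rwa [hx'] at h
  have ht0 : t ≠ 0 := by
    rintro rfl
    exact htp.1 (zero_pow hpp.ne_zero)
  obtain ⟨Y, hYdef⟩ : ∃ Y, Y = π ^ k * t := ⟨_, rfl⟩
  have hY0 : Y ≠ 0 := hYdef ▸ mul_ne_zero hπk ht0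
  obtain ⟨u, hudef⟩ : ∃ u, u = (x : K) / Y ^ p := ⟨_, rfl⟩
  have hxu : (x : K) = u * Y ^ p := by
    rw [hudef, div_mul_cancel₀ _ (pow_ne_zero _ hY0)]
  have hu1 : u - 1 ∈ hw.level 1 := by
    have h := hw.mul_mem_level htx (hw.mem_level_self (t ^ p)⁻¹)
    rw [hw.map_inv htp.1, htp.2, neg_zero, add_zero, sub_mul, mul_inv_cancel₀ htp.1] at h
    convert h using 2
    rw [hudef, hYdef, mul_pow]
    field_simp
  refine ⟨u, Y, hY0, ?_, hxu⟩
  by_contra! hcon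
  obtain ⟨ha0, haw⟩ := hcon
  have ha1 : 1 ≤ w (u - 1) := hu1 ha0
  obtain ⟨q, hq⟩ : ∃ q, q = (e - 1) / (p - 1) := ⟨_, rfl⟩
  have hi : ((p * e1s : ℕ) : ℤ) - bExp p e * s = e1s - q * s := by
    obtain ⟨m, rfl⟩ : ∃ m, p = m + 1 := ⟨p - 1, by have := hpp.one_lt; omega⟩
    rw [Nat.add_sub_cancel] at he1s
    have h : (m : ℤ) * e1s = e * s := by exact_mod_cast he1s
    rw [bExp, ← hq]
    push_cast
    linear_combination h
  have his : (e1s : ℤ) - q * s ≤ s := by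
    have h1 := Nat.lt_div_mul_add (a := e - 1) (b := p - 1) (by have := hpp.one_lt; omega)
    rw [← hq] at h1
    have h2 : e ≤ (q + 1) * (p - 1) := by
      rw [add_mul, one_mul]
      omega
    have h3 : (p - 1) * e1s ≤ (p - 1) * ((q + 1) * s) := by
      rw [he1s]
      calc e * s ≤ ((q + 1) * (p - 1)) * s := Nat.mul_le_mul_right _ h2
        _ = _ := by ring
    have h4 : e1s ≤ (q + 1) * s :=
      Nat.le_of_mul_le_mul_left h3 (by have := hpp.one_lt; omega)
    have h5 : (e1s : ℤ) ≤ (q + 1) * s := by exact_mod_cast h4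
    linarith
  rw [hi] at haw
  have hsp : (s : ℤ) < p := by exact_mod_cast hscard.trans_lt hcardlt
  have hse : (s : ℤ) ≤ w (p : K) := by
    rw [hew]
    exact_mod_cast Nat.le_mul_of_pos_left s he
  have hsdiv : (s : ℤ) ∣ w (u - 1) - e1s := by
    rw [← hlam, ← hw.map_div ha0 hl0]
    refine hw.dvd_of_map_sub_mem hsdvd hcardw hcard0 (div_ne_zero ha0 hl0) fun σ => ?_
    refine hw.map_div_sub_mem (τ := (σ : K →+* K)) (hσ σ) ha0 hl0 ?_ (hζσ σ)
    obtain ⟨y, hy0, hy⟩ := hx σ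
    have hσY : σ Y ≠ 0 := by simpa using hY0
    refine hw.map_sub_mul_mem hpp hwp (τ := (σ : K →+* K)) (hσ σ)
      (y := Y ^ (ω σ : ZMod p).val * y / σ Y) ha1 (by omega) (by omega)
      (div_ne_zero (mul_ne_zero (pow_ne_zero _ hY0) hy0) hσY) ?_
    rw [add_sub_cancel]
    change σ u = _
    rw [hxu, map_mul, map_pow] at hy
    rw [div_pow, ← mul_div_assoc, eq_div_iff (pow_ne_zero _ hσY), hy]
    ring
  have hsdiv' : (s : ℤ) ∣ e1s - q * s - w (u - 1) := by
    obtain ⟨m, hm⟩ := hsdiv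
    exact ⟨-m - q, by linear_combination -hm⟩
  have := Int.le_of_dvd (by omega) hsdiv'
  omega
end

section
/- The 𝔽_p-dimension of V equals 1 + ef = 1 + [F : ℚ_p]. -/
theorem exists_padicInt_teichmuller (p : ℕ) [Fact p.Prime] :
    ∃ τ : ZMod p →* ℤ_[p], ∀ a, PadicInt.toZMod (τ a) = a := by
  have key : ∀ (f : ℤ_[p] →+* ZMod p) (x : ℤ_[p]), PadicInt.toZMod x = f x := by
    intro f x
    obtain ⟨n, -, hn⟩ := PadicInt.exists_mem_range x
    rw [PadicInt.maximalIdeal_eq_span_p, Ideal.mem_span_singleton] at hn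
    obtain ⟨y, hy⟩ := hn
    obtain rfl : x = n + p * y := by rw [← hy]; ring
    simp
  refine ⟨(WittVector.equiv p).toRingHom.toMonoidHom.comp (WittVector.teichmuller p), fun a => ?_⟩
  rw [key ((WittVector.constantCoeff).comp (WittVector.equiv p).symm.toRingHom)]
  simp [WittVector.constantCoeff]

open Polynomial in
theorem exists_one_add_prime_mul_X_pow {p : ℕ} (hp : p.Prime) (hodd : Odd p) :
    ∃ h : ℤ[X], (1 + C (p : ℤ) * X) ^ p = 1 + C (p : ℤ) ^ 2 * X + C (p : ℤ) ^ 3 * h := by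
  obtain ⟨r, hr⟩ := exists_add_pow_prime_eq hp (1 : ℤ[X]) X
  have hp3 : 3 ≤ p := by
    have := hp.two_le
    obtain ⟨k, rfl⟩ := hodd
    omega
  have h0 : r.coeff 0 = 1 := by
    have := congrArg (fun q => Polynomial.coeff q 1) hr
    simp only [coeff_one_add_X_pow, Nat.choose_one_right, one_pow, coeff_add, coeff_X_pow,
      mul_one] at this
    rw [if_neg (by omega), coeff_one, if_neg (by omega), mul_assoc, ← C_eq_natCast, coeff_C_mul,
      coeff_X_mul] at this
    have hp0 : (p : ℤ) ≠ 0 := by exact_mod_cast hp.ne_zero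
    simpa [hp.ne_zero] using this
  obtain ⟨r', hr'⟩ : X ∣ r - 1 := by
    rw [X_dvd_iff]; simp [h0]
  obtain rfl : r = 1 + X * r' := by rw [← hr']; ring
  obtain ⟨k, rfl⟩ := Nat.exists_eq_add_of_le' hp3
  refine ⟨C ((k + 3 : ℕ) : ℤ) ^ k * X ^ (k + 3) + X ^ 2 * r'.comp (C ((k + 3 : ℕ) : ℤ) * X), ?_⟩
  have := congrArg (fun q => q.comp (C ((k + 3 : ℕ) : ℤ) * X)) hr
  simp only [add_comp, mul_comp, pow_comp, one_comp, X_comp, natCast_comp] at this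
  rw [this]
  rw [mul_pow]
  simp only [Nat.cast_add, eq_intCast, Int.cast_add, Int.cast_natCast]
  ring

theorem Nat.ModEq.pow_prime_pow {p a b : ℕ} (h : a ≡ b [MOD p]) (k : ℕ) :
    a ^ p ^ k ≡ b ^ p ^ k [MOD p ^ k] := by
  rw [Nat.modEq_iff_dvd] at h ⊢
  have := dvd_sub_pow_of_dvd_sub (p := p) h k
  push_cast
  exact (pow_dvd_pow _ k.le_succ).trans this

theorem natCard_eigen_quotient_eq {p : ℕ} [hp : Fact p.Prime] {G Q C : Type*} [Group G] [Finite G]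
    [CommGroup Q] [Finite Q] [CommGroup C] (hG : (Nat.card G).Coprime p) (ω : G →* (ZMod p)ˣ)
    (φ : G →* Monoid.End Q) (θ : Q →* C) (hθ : θ.ker = (powMonoidHom p : Q →* Q).range) :
    Nat.card {c : C // ∃ x, θ x = c ∧
      ∀ g, ∃ y, φ g x = x ^ (ω g : ZMod p).val * y ^ p} =
    Nat.card {x : Q // x ^ p = 1 ∧ ∀ g, φ g x = x ^ (ω g : ZMod p).val} := by
  classical
  have := Fintype.ofFinite G
  obtain ⟨m, q, hq, hE⟩ := Nat.exists_eq_pow_mul_and_not_dvd (n := Nat.card Q) Nat.card_pos.ne' p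
    hp.out.one_lt.ne'
  set M := m + 1 with hM
  have hpM : 1 < p ^ M := Nat.one_lt_pow (by omega) hp.out.one_lt
  have hpdvd : p ∣ p ^ M := dvd_pow_self _ (by omega)
  have hqQ : ∀ x : Q, (x ^ q) ^ p ^ M = 1 := fun x => by
    rw [← pow_mul, hM, pow_succ, ← mul_assoc, mul_comm q, ← hE, pow_mul, pow_card_eq_one', one_pow]
  have hmod : ∀ x : Q, x ^ p ^ M = 1 → ∀ {a b : ℕ}, a ≡ b [MOD p ^ M] → x ^ a = x ^ b := by
    intro x hx a b hab
    exact pow_eq_pow_iff_modEq.2 (hab.of_dvd (orderOf_dvd_of_pow_eq_one hx))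
  have hmodp : ∀ (x : Q) {a b : ℕ}, a ≡ b [MOD p] → ∃ y, x ^ a = x ^ b * y ^ p := by
    intro x a b hab
    obtain ⟨k, hk⟩ := (Nat.modEq_iff_dvd.1 hab.symm)
    refine ⟨x ^ k, ?_⟩
    have : (a : ℤ) = b + k * p := by rw [mul_comm]; omega
    rw [← zpow_natCast, this, zpow_add, zpow_mul, zpow_natCast, zpow_natCast]
  set t : G → ℕ := fun g => (ω g : ZMod p).val ^ p ^ M with ht
  have htmul : ∀ g h, t (g * h) ≡ t g * t h [MOD p ^ M] := by
    intro g h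
    rw [ht, ← mul_pow]
    apply Nat.ModEq.pow_prime_pow
    rw [map_mul, Units.val_mul, ZMod.val_mul]
    exact Nat.mod_modEq _ _
  have ht1 : t 1 = 1 := by
    have : Fact (1 < p) := ⟨hp.out.one_lt⟩
    simp [ht, ZMod.val_one]
  have htω : ∀ g, t g ≡ (ω g : ZMod p).val [MOD p] := by
    intro g
    rw [← ZMod.natCast_eq_natCast_iff]
    simp [ht, ZMod.pow_card_pow]
  have htinv : ∀ g, t g * t g⁻¹ ≡ 1 [MOD p ^ M] := fun g => by
    have := htmul g g⁻¹
    rw [mul_inv_cancel, ht1] at this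
    exact this.symm
  obtain ⟨c, -, hc⟩ := Nat.exists_mul_mod_eq_one_of_coprime (n := q * Nat.card G) (k := p ^ M)
    (Nat.Coprime.pow_right _ (Nat.Coprime.mul_left
      ((Nat.Prime.coprime_iff_not_dvd hp.out).2 hq).symm hG)) hpM
  have hc' : q * c * Nat.card G ≡ 1 [MOD p ^ M] := by
    rw [Nat.ModEq, Nat.mod_eq_of_lt hpM, ← hc]; congr 1; ring
  set P : Q → Q := fun x => ∏ g, φ g (x ^ (q * c)) ^ t g⁻¹ with hP
  have hkill : ∀ x : Q, (x ^ (q * c)) ^ p ^ M = 1 := fun x => by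
    rw [mul_comm, pow_mul]; exact hqQ _
  have hPM : ∀ x, P x ^ p ^ M = 1 := fun x => by
    rw [hP, ← Finset.prod_pow]
    refine Finset.prod_eq_one fun g _ => ?_
    rw [pow_right_comm, ← map_pow, hkill, map_one, one_pow]
  have hPφ : ∀ h x, φ h (P x) = P x ^ t h := fun h x => by
    rw [hP, ← Finset.prod_pow, map_prod]
    refine Fintype.prod_equiv (Equiv.mulLeft h) _ _ fun g => ?_
    rw [map_pow, Equiv.coe_mulLeft, map_mul, ← pow_mul]
    refine hmod (φ h (φ g (x ^ (q * c)))) ?_ ?_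
    · rw [← map_pow, ← map_pow, hkill, map_one, map_one]
    · have := htmul (h * g)⁻¹ h
      simpa using this
  have hPpow : ∀ x (n : ℕ), P (x ^ n) = P x ^ n := fun x n => by
    simp only [hP, ← Finset.prod_pow, map_pow, ← pow_mul]
    refine Finset.prod_congr rfl fun g _ => ?_
    congr 1; ring
  let H : Subgroup Q :=
    { carrier := {x | x ^ p ^ M = 1 ∧ ∀ g, φ g x = x ^ t g}
      one_mem' := by simp
      mul_mem' := fun {a b} ha hb => ⟨by rw [mul_pow, ha.1, hb.1, one_mul], fun g => by
        rw [map_mul, ha.2, hb.2, mul_pow]⟩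
      inv_mem' := fun {a} ha => ⟨by rw [inv_pow, ha.1, inv_one], fun g => by
        rw [map_inv, ha.2, inv_pow]⟩ }
  have hPH : ∀ x, P x ∈ H := fun x => ⟨hPM x, fun g => hPφ g x⟩
  have hPid : ∀ x ∈ H, P x = x := fun x hx => by
    have : ∀ g, φ g (x ^ (q * c)) ^ t g⁻¹ = x ^ (q * c) := fun g => by
      rw [map_pow, hx.2, ← pow_mul, ← pow_mul]
      refine hmod x hx.1 ?_
      rw [mul_comm (q * c), ← mul_assoc]
      simpa only [one_mul] using (htinv g).mul_right (q * c)
    rw [hP]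
    simp only [this, Finset.prod_const, Finset.card_univ, ← Nat.card_eq_fintype_card, ← pow_mul]
    rw [hmod x hx.1 hc', pow_one]
  have hPeig : ∀ x, (∀ g, ∃ y, φ g x = x ^ (ω g : ZMod p).val * y ^ p) →
      ∃ y, P x = x * y ^ p := by
    intro x hx
    have : ∀ g, ∃ y, φ g (x ^ (q * c)) ^ t g⁻¹ = x ^ (q * c) * y ^ p := by
      intro g
      obtain ⟨y, hy⟩ := hx g
      obtain ⟨z, hz⟩ := hmodp (x ^ (q * c)) (a := (ω g : ZMod p).val * t g⁻¹) (b := 1)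
        (((htω g).symm.mul_right _).trans ((htinv g).of_dvd hpdvd))
      refine ⟨z * y ^ (q * c * t g⁻¹), ?_⟩
      rw [map_pow, hy, mul_pow, mul_pow, mul_pow, ← mul_assoc, ← pow_one (x ^ (q * c)), ← hz]
      simp only [← pow_mul]
      congr 2 <;> ring
    choose y hy using this
    obtain ⟨z, hz⟩ := hmodp x (hc'.of_dvd hpdvd)
    refine ⟨z * ∏ g, y g, ?_⟩
    rw [hP]
    simp only [hy, Finset.prod_mul_distrib, Finset.prod_const, Finset.card_univ,
      ← Nat.card_eq_fintype_card, ← pow_mul, Finset.prod_pow]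
    rw [hz, mul_pow, pow_one, mul_assoc]
  let f : H →* C := θ.comp H.subtype
  have hfker : f.ker = (powMonoidHom p : H →* H).range := by
    ext x
    constructor
    · intro hx
      have : (x : Q) ∈ θ.ker := hx
      rw [hθ] at this
      obtain ⟨y, hy⟩ := this
      refine ⟨⟨P y, hPH y⟩, Subtype.ext ?_⟩
      simp only [powMonoidHom_apply] at hy ⊢
      rw [Subgroup.coe_pow, ← hPpow, hy, hPid _ x.2]
    · rintro ⟨y, rfl⟩
      have : ((y : Q)) ^ p ∈ θ.ker := by rw [hθ]; exact ⟨y, rfl⟩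
      exact this
  have hrange : ∀ c : C, c ∈ f.range ↔ ∃ x, θ x = c ∧
      ∀ g, ∃ y, φ g x = x ^ (ω g : ZMod p).val * y ^ p := by
    intro c
    constructor
    · rintro ⟨x, rfl⟩
      refine ⟨x, rfl, fun g => ?_⟩
      rw [x.2.2 g]
      exact hmodp _ (htω g)
    · rintro ⟨x, rfl, hx⟩
      obtain ⟨y, hy⟩ := hPeig x hx
      refine ⟨⟨P x, hPH x⟩, ?_⟩
      have hyk : y ^ p ∈ θ.ker := by rw [hθ]; exact ⟨y, rfl⟩
      change θ (P x) = _
      rw [hy, map_mul, MonoidHom.mem_ker.1 hyk, mul_one]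
  have e1 : Nat.card {c : C // ∃ x, θ x = c ∧
      ∀ g, ∃ y, φ g x = x ^ (ω g : ZMod p).val * y ^ p} = Nat.card f.range :=
    Nat.card_congr (Equiv.subtypeEquivRight fun c => (hrange c).symm)
  have e2 : Nat.card {x : Q // x ^ p = 1 ∧ ∀ g, φ g x = x ^ (ω g : ZMod p).val} =
      Nat.card (powMonoidHom p : H →* H).ker := by
    refine Nat.card_congr
      { toFun := fun x => ⟨⟨x.1, ?_, ?_⟩, ?_⟩
        invFun := fun x => ⟨x.1.1, ?_, ?_⟩
        left_inv := fun _ => rfl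
        right_inv := fun _ => rfl }
    · obtain ⟨k, hk⟩ := hpdvd
      rw [hk, pow_mul, x.2.1, one_pow]
    · intro g
      rw [x.2.2 g]
      exact pow_eq_pow_iff_modEq.2 ((htω g).symm.of_dvd (orderOf_dvd_of_pow_eq_one x.2.1))
    · exact Subtype.ext x.2.1
    · exact congrArg Subtype.val x.2
    · intro g
      rw [x.1.2.2 g]
      exact pow_eq_pow_iff_modEq.2 ((htω g).of_dvd (orderOf_dvd_of_pow_eq_one
        (congrArg Subtype.val x.2)))
  rw [e1, e2, ← Subgroup.index_ker, hfker]
  have h1 := Subgroup.card_mul_index (powMonoidHom p : H →* H).ker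
  have h2 := Subgroup.card_mul_index (powMonoidHom p : H →* H).range
  rw [Subgroup.index_ker] at h1
  have h3 : 0 < Nat.card (powMonoidHom p : H →* H).range := Nat.card_pos
  rw [← h2, mul_comm] at h1
  exact (Nat.eq_of_mul_eq_mul_left h3 h1).symm

theorem dvd_one_add_mul_pow_sub {O : Type*} [CommRing O] (q y : O) (n : ℕ) :
    q ^ 2 ∣ (1 + q * y) ^ n - (1 + n * (q * y)) := by
  induction n with
  | zero => simp
  | succ n ih =>
    obtain ⟨c, hc⟩ := ih
    refine ⟨c * (1 + q * y) + n * y ^ 2, ?_⟩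
    rw [pow_succ, sub_eq_iff_eq_add.1 hc]
    push_cast
    ring

section Ring

variable {O : Type*} [CommRing O] {p : ℕ}

/-- The units of `O` which are congruent to `1` modulo `a`. -/
def congruenceUnits (a : O) : Subgroup Oˣ :=
  (Units.map (Ideal.Quotient.mk (Ideal.span {a})).toMonoidHom).ker

theorem mem_congruenceUnits {a : O} {u : Oˣ} : u ∈ congruenceUnits a ↔ a ∣ u - 1 := by
  rw [congruenceUnits, MonoidHom.mem_ker, Units.ext_iff, ← Ideal.mem_span_singleton,
    ← Ideal.Quotient.mk_eq_mk_iff_sub_mem]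
  simp

theorem mk_congruenceUnits_eq_iff {a : O} {u v : Oˣ} :
    (QuotientGroup.mk u : Oˣ ⧸ congruenceUnits a) = QuotientGroup.mk v ↔ a ∣ (v : O) - u := by
  rw [QuotientGroup.eq, mem_congruenceUnits, ← (u.isUnit.dvd_mul_left), mul_sub]
  simp

instance (a : O) [Finite (O ⧸ Ideal.span {a})] : Finite (Oˣ ⧸ congruenceUnits a) :=
  Finite.of_injective _ (QuotientGroup.kerLift_injective
    (Units.map (Ideal.Quotient.mk (Ideal.span {a})).toMonoidHom))

variable [IsDomain O]

theorem eq_zero_of_one_add_prime_mul_pow_eq_one (hp : p.Prime) (hodd : Odd p) (hp0 : (p : O) ≠ 0)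
    (hunit : ∀ y : O, IsUnit (1 + p * y)) {y : O} (hy : (1 + p * y) ^ p = 1) : y = 0 := by
  obtain ⟨h, hh⟩ := exists_one_add_prime_mul_X_pow hp hodd
  have h0 : h.eval 0 = 0 := by
    have := congrArg (Polynomial.eval 0) hh
    simpa [hp.ne_zero] using this
  obtain ⟨h', rfl⟩ : Polynomial.X ∣ h := by
    rwa [Polynomial.X_dvd_iff, Polynomial.coeff_zero_eq_eval_zero]
  have := congrArg (Polynomial.aeval y) hh
  simp only [map_pow, map_add, map_mul, map_one, Polynomial.aeval_X, map_natCast, hy] at this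
  have h3 : (p : O) ^ 2 * (y * (1 + p * Polynomial.aeval y h')) = 0 := by
    linear_combination -this
  simpa [hp0, (hunit _).ne_zero] using h3

theorem Units.eq_one_of_pow_prime_eq_one (hp : p.Prime) (hodd : Odd p) (hp0 : (p : O) ≠ 0)
    (hunit : ∀ y : O, IsUnit (1 + p * y)) {u : Oˣ} (hu : u ^ p = 1) (h : (p : O) ∣ u - 1) :
    u = 1 := by
  obtain ⟨y, hy⟩ := h
  have hy' : (u : O) = 1 + p * y := by rw [← hy]; ring
  have : (1 + p * y) ^ p = 1 := by rw [← hy', ← Units.val_pow_eq_pow_val, hu, Units.val_one]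
  ext
  rw [hy', eq_zero_of_one_add_prime_mul_pow_eq_one hp hodd hp0 hunit this]
  simp

theorem natCard_eigen_torsion_eq [hp : Fact p.Prime] (hodd : Odd p) (hp0 : (p : O) ≠ 0)
    (hunit : ∀ y : O, IsUnit (1 + p * y))
    (hpow : ∀ z : O, ∃ y, (1 + p * y) ^ p = 1 + (p : O) ^ 2 * z)
    {ζ : O} (hζ : IsPrimitiveRoot ζ p) {G : Type*} (φ : G → O →+* O) (a : G → ℕ)
    (hφζ : ∀ g, φ g ζ = ζ ^ a g) :
    Nat.card {q : Oˣ ⧸ congruenceUnits ((p : O) ^ 2) // ∃ u : Oˣ, QuotientGroup.mk u = q ∧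
      (p : O) ^ 2 ∣ u ^ p - 1 ∧ ∀ g, (p : O) ^ 2 ∣ φ g u - u ^ a g} =
    p * Nat.card {d : O ⧸ Ideal.span {(p : O)} // ∃ y : O, Ideal.Quotient.mk _ y = d ∧
      ∀ g, (p : O) ∣ φ g y - a g * y} := by
  have hp2 : (p : O) ∣ (p : O) ^ 2 := dvd_pow_self _ two_ne_zero
  let ε : O → Oˣ := fun y => (hunit y).unit
  have hε : ∀ y, (ε y : O) = 1 + p * y := fun y => rfl
  obtain ⟨z, hz⟩ : ∃ z : Oˣ, (z : O) = ζ := ⟨_, (hζ.isUnit hp.out.ne_zero).unit_spec⟩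
  have hzp : IsPrimitiveRoot z p := by
    rw [← IsPrimitiveRoot.coe_units_iff, hz]; exact hζ
  have hφz : ∀ g (i : ℕ), φ g ((z ^ i : Oˣ) : O) = ((z ^ (i * a g) : Oˣ) : O) := fun g i => by
    simp only [Units.val_pow_eq_pow_val, hz, map_pow, hφζ, ← pow_mul, mul_comm]
  have key : ∀ (g : G) (i : ℕ) (y : O), ((p : O) ^ 2 ∣
      φ g ((z ^ i * ε y : Oˣ) : O) - ((z ^ i * ε y : Oˣ) : O) ^ a g) ↔ (p : O) ∣ φ g y - a g * y := by
    intro g i y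
    have h1 : φ g ((z ^ i * ε y : Oˣ) : O) - ((z ^ i * ε y : Oˣ) : O) ^ a g =
        ((z ^ (i * a g) : Oˣ) : O) * (p * (φ g y - a g * y) -
          ((1 + p * y) ^ a g - (1 + a g * (p * y)))) := by
      rw [Units.val_mul, map_mul, hφz, hε, mul_pow, ← Units.val_pow_eq_pow_val, ← pow_mul]
      simp only [map_add, map_one, map_mul, map_natCast]
      ring
    rw [h1, Units.dvd_mul_left, dvd_sub_left (dvd_one_add_mul_pow_sub _ _ _), pow_two,
      mul_dvd_mul_iff_left hp0]
  choose! l hl using fun (d : {d : O ⧸ Ideal.span {(p : O)} // ∃ y : O, Ideal.Quotient.mk _ y = d ∧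
      ∀ g, (p : O) ∣ φ g y - a g * y}) => d.2
  have hpowp : ∀ (i : ℕ) (y : O), (p : O) ^ 2 ∣ ((z ^ i * ε y : Oˣ) : O) ^ p - 1 := by
    intro i y
    rw [← Units.val_pow_eq_pow_val, mul_pow, pow_right_comm, hzp.pow_eq_one, one_pow, one_mul,
      Units.val_pow_eq_pow_val, hε]
    have h1 := dvd_one_add_mul_pow_sub (p : O) y p
    have h2 : (1 + p * y) ^ p - 1 = ((1 + p * y) ^ p - (1 + p * (p * y))) + (p : O) ^ 2 * y := by
      ring
    rw [h2]
    exact dvd_add h1 (dvd_mul_right _ _)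
  have hc : ∀ n, p * n = Nat.card (Fin p) * n := by simp
  rw [hc, ← Nat.card_prod]
  refine (Nat.card_eq_of_bijective (fun x => ⟨QuotientGroup.mk (z ^ (x.1 : ℕ) * ε (l x.2)),
    _, rfl, by simpa using hpowp x.1 (l x.2), fun g => (key g _ _).2 ((hl x.2).2 g)⟩) ⟨?_, ?_⟩).symm
  · rintro ⟨i, d⟩ ⟨j, d'⟩ h
    rw [Subtype.mk.injEq, mk_congruenceUnits_eq_iff] at h
    simp only [Units.val_mul, hε] at h
    have hij : z ^ (j : ℕ) = z ^ (i : ℕ) := by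
      rw [← div_eq_one]
      refine Units.eq_one_of_pow_prime_eq_one hp.out hodd hp0 hunit ?_ ?_
      · rw [div_pow, pow_right_comm, hzp.pow_eq_one, pow_right_comm, hzp.pow_eq_one]
        simp
      · rw [← (z ^ (i : ℕ)).isUnit.dvd_mul_left, mul_sub, ← Units.val_mul, mul_div_cancel]
        have h1 : ((z ^ (j : ℕ) : Oˣ) : O) - (z ^ (i : ℕ) : Oˣ) * 1 =
            ((z ^ (j : ℕ) : Oˣ) * (1 + p * l d') - (z ^ (i : ℕ) : Oˣ) * (1 + p * l d)) -
            p * ((z ^ (j : ℕ) : Oˣ) * l d' - (z ^ (i : ℕ) : Oˣ) * l d) := by ring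
        rw [h1]
        exact dvd_sub (hp2.trans h) (dvd_mul_right _ _)
    obtain rfl : i = j := Fin.ext (hzp.pow_inj i.2 j.2 hij.symm)
    rw [← mul_sub, Units.dvd_mul_left, add_sub_add_left_eq_sub, ← mul_sub, pow_two,
      mul_dvd_mul_iff_left hp0] at h
    congr 1
    rw [Subtype.ext_iff, ← (hl d).1, ← (hl d').1]
    exact ((Ideal.Quotient.mk_eq_mk_iff_sub_mem _ _).2 (Ideal.mem_span_singleton.2 h)).symm
  · rintro ⟨_, u, rfl, ⟨c, hc⟩, hu2⟩
    obtain ⟨y, hy⟩ := hpow c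
    have h1 : (u / ε y) ^ p = 1 := by
      rw [div_pow, div_eq_one]
      ext
      rw [Units.val_pow_eq_pow_val, Units.val_pow_eq_pow_val, hε, hy, ← hc]
      ring
    obtain ⟨i, hi, hiu⟩ := (IsPrimitiveRoot.coe_units_iff.2 hzp).eq_pow_of_pow_eq_one
      (ξ := ((u / ε y : Oˣ) : O)) (by rw [← Units.val_pow_eq_pow_val, h1, Units.val_one])
    rw [← Units.val_pow_eq_pow_val, Units.val_inj, eq_div_iff_mul_eq'] at hiu
    subst hiu
    refine ⟨⟨⟨i, hi⟩, ⟨Ideal.Quotient.mk _ y, y, rfl, fun g => (key g i y).1 (hu2 g)⟩⟩, ?_⟩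
    rw [Subtype.mk.injEq, mk_congruenceUnits_eq_iff]
    set d : {d : O ⧸ Ideal.span {(p : O)} // ∃ y : O, Ideal.Quotient.mk _ y = d ∧
      ∀ g, (p : O) ∣ φ g y - a g * y} := ⟨Ideal.Quotient.mk _ y, _⟩ with hd
    have h2 := (hl d).1
    rw [hd, Ideal.Quotient.mk_eq_mk_iff_sub_mem, Ideal.mem_span_singleton, ← hd] at h2
    rw [Units.val_mul, Units.val_mul, ← mul_sub, Units.dvd_mul_left, hε, hε,
      add_sub_add_left_eq_sub, ← mul_sub, pow_two, mul_dvd_mul_iff_left hp0, dvd_sub_comm]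
    exact h2

theorem natCard_eigen_units_eq [hp : Fact p.Prime] (hodd : Odd p) (hp0 : (p : O) ≠ 0)
    (hunit : ∀ y : O, IsUnit (1 + p * y))
    (hpow : ∀ z : O, ∃ y, (1 + p * y) ^ p = 1 + (p : O) ^ 2 * z)
    [Finite (O ⧸ Ideal.span {(p : O) ^ 2})]
    {ζ : O} (hζ : IsPrimitiveRoot ζ p) {G : Type*} [Group G] [Finite G]
    (hG : (Nat.card G).Coprime p) (φ : G →* (O →+* O)) (ω : G →* (ZMod p)ˣ)
    (hφζ : ∀ g, φ g ζ = ζ ^ (ω g : ZMod p).val)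
    {C : Type*} [CommGroup C] (f : Oˣ →* C) (hf : f.ker = (powMonoidHom p : Oˣ →* Oˣ).range) :
    Nat.card {c : C // ∃ u : Oˣ, f u = c ∧ ∀ g, ∃ v : Oˣ,
      φ g u = u ^ (ω g : ZMod p).val * (v : O) ^ p} =
    p * Nat.card {d : O ⧸ Ideal.span {(p : O)} // ∃ y : O, Ideal.Quotient.mk _ y = d ∧
      ∀ g, (p : O) ∣ φ g y - (ω g : ZMod p).val * y} := by
  rw [← natCard_eigen_torsion_eq hodd hp0 hunit hpow hζ (fun g => φ g) _ hφζ]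
  set B := congruenceUnits ((p : O) ^ 2) with hB
  have hBpow : ∀ b ∈ B, ∃ v : Oˣ, v ^ p = b := by
    intro b hb
    obtain ⟨c, hc⟩ := mem_congruenceUnits.1 hb
    obtain ⟨y, hy⟩ := hpow c
    refine ⟨(hunit y).unit, Units.ext ?_⟩
    rw [Units.val_pow_eq_pow_val, IsUnit.unit_spec, hy, ← hc]
    ring
  let θ : Oˣ ⧸ B →* C := QuotientGroup.lift B f fun b hb => by
    rw [hf]
    exact hBpow b hb
  have hθ : θ.ker = (powMonoidHom (α := Oˣ ⧸ B) p).range := by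
    ext x
    obtain ⟨u, rfl⟩ := QuotientGroup.mk_surjective x
    constructor
    · intro h
      have : u ∈ f.ker := h
      rw [hf] at this
      obtain ⟨v, rfl⟩ := this
      exact ⟨QuotientGroup.mk v, rfl⟩
    · rintro ⟨y, hy⟩
      obtain ⟨v, rfl⟩ := QuotientGroup.mk_surjective y
      rw [← hy, MonoidHom.mem_ker]
      have : v ^ p ∈ f.ker := by rw [hf]; exact ⟨v, rfl⟩
      exact this
  have hφB : ∀ g, B ≤ B.comap (Units.map (φ g : O →* O)) := by
    intro g b hb
    rw [Subgroup.mem_comap, mem_congruenceUnits]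
    have := map_dvd (φ g) (mem_congruenceUnits.1 hb)
    simpa using this
  let Φ : G →* Monoid.End (Oˣ ⧸ B) :=
    { toFun := fun g => QuotientGroup.map B B (Units.map (φ g : O →* O)) (hφB g)
      map_one' := by
        ext x
        obtain ⟨u, rfl⟩ := QuotientGroup.mk_surjective x
        refine congrArg QuotientGroup.mk (Units.ext ?_)
        simp
      map_mul' := fun g h => by
        ext x
        obtain ⟨u, rfl⟩ := QuotientGroup.mk_surjective x
        refine congrArg QuotientGroup.mk (Units.ext ?_)
        simp }
  have hΦ : ∀ g (u : Oˣ), Φ g (QuotientGroup.mk u) =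
    QuotientGroup.mk (Units.map (φ g : O →* O) u) := fun g u => rfl
  have main := natCard_eigen_quotient_eq (Q := Oˣ ⧸ B) hG ω Φ θ hθ
  have e1 : ∀ c : C, (∃ u : Oˣ, f u = c ∧ ∀ g, ∃ v : Oˣ,
      φ g u = u ^ (ω g : ZMod p).val * (v : O) ^ p) ↔ ∃ x, θ x = c ∧
      ∀ g, ∃ y, Φ g x = x ^ (ω g : ZMod p).val * y ^ p := by
    intro c
    constructor
    · rintro ⟨u, rfl, hu⟩
      refine ⟨QuotientGroup.mk u, rfl, fun g => ?_⟩
      obtain ⟨v, hv⟩ := hu g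
      refine ⟨QuotientGroup.mk v, ?_⟩
      rw [hΦ, ← QuotientGroup.mk_pow, ← QuotientGroup.mk_pow, ← QuotientGroup.mk_mul]
      exact congrArg QuotientGroup.mk (Units.ext (by simpa using hv))
    · rintro ⟨x, rfl, hx⟩
      obtain ⟨u, rfl⟩ := QuotientGroup.mk_surjective x
      refine ⟨u, rfl, fun g => ?_⟩
      obtain ⟨y, hy⟩ := hx g
      obtain ⟨v, rfl⟩ := QuotientGroup.mk_surjective y
      rw [hΦ, ← QuotientGroup.mk_pow, ← QuotientGroup.mk_pow, ← QuotientGroup.mk_mul,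
        eq_comm, QuotientGroup.eq] at hy
      obtain ⟨w, hw⟩ := hBpow _ hy
      refine ⟨v * w, ?_⟩
      rw [eq_inv_mul_iff_mul_eq] at hw
      have := congrArg Units.val hw
      simp only [Units.val_mul, Units.val_pow_eq_pow_val, Units.coe_map, MonoidHom.coe_coe] at this
      rw [← this, Units.val_mul]
      ring
  rw [Nat.card_congr (Equiv.subtypeEquivRight e1), main]
  refine Nat.card_congr (Equiv.subtypeEquivRight fun q => ?_)
  constructor
  · rintro ⟨h1, h2⟩
    obtain ⟨u, rfl⟩ := QuotientGroup.mk_surjective q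
    refine ⟨u, rfl, ?_, fun g => ?_⟩
    · rw [← QuotientGroup.mk_pow, ← QuotientGroup.mk_one, eq_comm, mk_congruenceUnits_eq_iff] at h1
      simpa using h1
    · have := h2 g
      rw [hΦ, ← QuotientGroup.mk_pow, eq_comm, mk_congruenceUnits_eq_iff] at this
      simpa using this
  · rintro ⟨u, rfl, h1, h2⟩
    refine ⟨?_, fun g => ?_⟩
    · rw [← QuotientGroup.mk_pow, ← QuotientGroup.mk_one, eq_comm, mk_congruenceUnits_eq_iff]
      simpa using h1
    · rw [hΦ, ← QuotientGroup.mk_pow, eq_comm, mk_congruenceUnits_eq_iff]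
      simpa using h2 g

end Ring

section Eigen

section

variable {R A G : Type*} [CommRing R] [CommRing A] [Algebra R A]

/-- The submodule of elements on which a group acts through the character `χ`. -/
def eigenSubmodule (φ : G → A →ₐ[R] A) (χ : G → Rˣ) : Submodule R A where
  carrier := {x | ∀ g, φ g x = (χ g : R) • x}
  add_mem' := fun hx hy g => by rw [map_add, hx, hy, smul_add]
  zero_mem' := fun g => by simp
  smul_mem' := fun c x hx g => by rw [map_smul, hx, smul_comm]

theorem sum_smul_mem_eigenSubmodule [Group G] [Fintype G] (φ : G →* (A →ₐ[R] A)) (χ : G →* Rˣ)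
    (x : A) : ∑ g, (χ g⁻¹ : R) • φ g x ∈ eigenSubmodule φ χ := by
  intro h
  rw [map_sum, Finset.smul_sum]
  refine Fintype.sum_equiv (Equiv.mulLeft h) _ _ fun g => ?_
  rw [Equiv.coe_mulLeft, map_mul, AlgHom.mul_apply, map_smul, smul_smul, ← Units.val_mul, ← map_mul]
  simp

variable [IsDomain A] [Group G] [Finite G] {φ : G →* (A →ₐ[R] A)}

theorem exists_ne_zero_mem_eigenSubmodule (hφ : Function.Injective φ) (χ : G →* Rˣ) :
    ∃ x ∈ eigenSubmodule φ χ, x ≠ 0 := by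
  have := Fintype.ofFinite G
  by_contra! h
  have hli := (linearIndependent_monoidHom A A).comp (fun g => ((φ g : A →ₐ[R] A) : A →* A))
    fun g h hgh => hφ (AlgHom.ext fun x => DFunLike.congr_fun hgh x)
  have h0 := Fintype.linearIndependent_iff.1 hli (fun g => algebraMap R A (χ g⁻¹ : R)) (by
    ext x
    simpa [Algebra.smul_def] using h _ (sum_smul_mem_eigenSubmodule φ χ x)) 1
  simp at h0

theorem finrank_eigenSubmodule_le [IsDomain R] [IsPrincipalIdealRing R] [Module.Finite R A]
    (hφ : Function.Injective φ) (χ ψ : G →* Rˣ) :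
    Module.finrank R (eigenSubmodule φ χ) ≤ Module.finrank R (eigenSubmodule φ ψ) := by
  obtain ⟨a, ha, ha0⟩ := exists_ne_zero_mem_eigenSubmodule hφ (ψ / χ)
  have hmaps : ∀ x ∈ eigenSubmodule φ χ, LinearMap.mulRight R a x ∈ eigenSubmodule φ ψ := by
    intro x hx g
    rw [LinearMap.mulRight_apply, map_mul, hx, ha, smul_mul_smul_comm, ← Units.val_mul]
    simp
  refine LinearMap.finrank_le_finrank_of_injective
    (f := (LinearMap.mulRight R a).restrict hmaps) fun x y hxy => ?_
  have := congrArg Subtype.val hxy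
  exact Subtype.ext (mul_right_cancel₀ ha0 this)

end

theorem natCard_eigen_quotient_prime_eq {p : ℕ} [hp : Fact p.Prime] {O : Type*} [CommRing O]
    [IsDomain O] [Algebra ℤ_[p] O] [FaithfulSMul ℤ_[p] O] [Module.Finite ℤ_[p] O]
    {G : Type*} [Group G] [Finite G] (hG : (Nat.card G).Coprime p) {φ : G →* (O →ₐ[ℤ_[p]] O)}
    (hφ : Function.Injective φ) (ω : G →* (ZMod p)ˣ) :
    Nat.card {d : O ⧸ Ideal.span {(p : O)} // ∃ y : O, Ideal.Quotient.mk _ y = d ∧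
      ∀ g, (p : O) ∣ φ g y - (ω g : ZMod p).val * y} =
    p ^ Module.finrank ℤ_[p] (eigenSubmodule φ (1 : G →* ℤ_[p]ˣ)) := by
  have := Fintype.ofFinite G
  obtain ⟨τ, hτ⟩ := exists_padicInt_teichmuller p
  let χ : G →* ℤ_[p]ˣ := (Units.map τ).comp ω
  have hχ : ∀ g (y : O), (p : O) ∣ (χ g : ℤ_[p]) • y - (ω g : ZMod p).val * y := by
    intro g y
    have h1 : χ g - ((ω g : ZMod p).val : ℤ_[p]) ∈ RingHom.ker (PadicInt.toZMod (p := p)) := by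
      rw [RingHom.mem_ker, map_sub, map_natCast]
      simp [χ, hτ]
    rw [PadicInt.ker_toZMod, PadicInt.maximalIdeal_eq_span_p, Ideal.mem_span_singleton] at h1
    have h2 := (map_dvd (algebraMap ℤ_[p] O) h1).mul_right y
    rwa [map_natCast, map_sub, map_natCast, sub_mul, ← Algebra.smul_def] at h2
  have hχ' : ∀ g (y : O), (p : O) ∣ φ g y - (ω g : ZMod p).val * y ↔
      (p : O) ∣ φ g y - (χ g : ℤ_[p]) • y := fun g y => by
    rw [← dvd_sub_left (hχ g y)]
    simp
  simp only [hχ']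
  set M := eigenSubmodule φ χ with hM
  have hrank : Module.finrank ℤ_[p] (eigenSubmodule φ (1 : G →* ℤ_[p]ˣ)) =
      Module.finrank ℤ_[p] M :=
    (finrank_eigenSubmodule_le hφ _ _).antisymm (finrank_eigenSubmodule_le hφ _ _)
  rw [hrank]
  set r := Module.finrank ℤ_[p] M with hr
  have hp0 : (p : O) ≠ 0 := by
    rw [← map_natCast (algebraMap ℤ_[p] O), Ne, FaithfulSMul.algebraMap_eq_zero_iff]
    exact_mod_cast hp.out.ne_zero
  let b := (Module.finBasis ℤ_[p] M).equivFun
  let α : M →+ (Fin r → ZMod p) :=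
    (AddMonoidHom.compLeft (PadicInt.toZMod (p := p)).toAddMonoidHom (Fin r)).comp
      b.toAddEquiv.toAddMonoidHom
  let β : M →+ O ⧸ Ideal.span {(p : O)} :=
    (Ideal.Quotient.mk (Ideal.span {(p : O)})).toAddMonoidHom.comp M.subtype.toAddMonoidHom
  have hα : ∀ m, m ∈ α.ker ↔ ∃ m', m = (p : ℤ_[p]) • m' := by
    intro m
    have h1 : m ∈ α.ker ↔ ∀ i, PadicInt.toZMod (b m i) = 0 := funext_iff
    have h2 : ∀ x : ℤ_[p], PadicInt.toZMod x = 0 ↔ (p : ℤ_[p]) ∣ x := fun x => by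
      rw [← RingHom.mem_ker, PadicInt.ker_toZMod, PadicInt.maximalIdeal_eq_span_p,
        Ideal.mem_span_singleton]
    simp only [h1, h2]
    constructor
    · intro h
      choose c hc using h
      refine ⟨b.symm c, b.injective ?_⟩
      ext1 i
      simp [hc]
    · rintro ⟨m', rfl⟩ i
      simp
  have hβ : ∀ m, m ∈ β.ker ↔ ∃ m', m = (p : ℤ_[p]) • m' := by
    intro m
    have h1 : m ∈ β.ker ↔ (p : O) ∣ m := by
      rw [← Ideal.mem_span_singleton, ← Ideal.Quotient.eq_zero_iff_mem]
      rfl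
    rw [h1]
    constructor
    · rintro ⟨y, hy⟩
      refine ⟨⟨y, fun g => mul_left_cancel₀ hp0 ?_⟩, Subtype.ext ?_⟩
      · have := m.2 g
        rw [hy, map_mul, map_natCast] at this
        rw [this, mul_smul_comm]
      · refine hy.trans ?_
        simp [Algebra.smul_def]
    · rintro ⟨m', rfl⟩
      simp [Algebra.smul_def]
  have hαs : Function.Surjective α := by
    have : Function.Surjective (PadicInt.toZMod (p := p)) := ZMod.ringHom_surjective _
    exact this.comp_left.comp b.surjective
  have hcard : Nat.card β.range = p ^ r := by
    rw [← AddSubgroup.index_ker, show β.ker = α.ker by ext m; rw [hα, hβ], AddSubgroup.index_ker,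
      AddMonoidHom.range_eq_top.2 hαs]
    simp
  rw [← hcard]
  refine Nat.card_congr (Equiv.subtypeEquivRight fun d => ?_)
  constructor
  · rintro ⟨y, rfl, hy⟩
    obtain ⟨c, hc⟩ : ∃ c : ℤ_[p], c * (Nat.card G : ℤ_[p]) = 1 := by
      refine (PadicInt.isUnit_iff.2 ?_).exists_left_inv
      rw [PadicInt.norm_natCast_eq_one_iff]
      exact hG.symm
    refine ⟨⟨c • ∑ g, (χ g⁻¹ : ℤ_[p]) • φ g y, M.smul_mem _ (sum_smul_mem_eigenSubmodule φ χ y)⟩, ?_⟩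
    refine (Ideal.Quotient.mk_eq_mk_iff_sub_mem _ _).2 (Ideal.mem_span_singleton.2 ?_)
    have h1 : c • ∑ g, (χ g⁻¹ : ℤ_[p]) • φ g y - y =
        c • ∑ g, (χ g⁻¹ : ℤ_[p]) • (φ g y - (χ g : ℤ_[p]) • y) := by
      simp only [smul_sub, Finset.sum_sub_distrib, smul_smul, ← Units.val_mul, ← map_mul]
      simp only [inv_mul_cancel, map_one, Units.val_one, one_smul, Finset.sum_const,
        Finset.card_univ, ← Nat.card_eq_fintype_card]
      rw [← Nat.cast_smul_eq_nsmul ℤ_[p], smul_smul, hc, one_smul]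
    change (p : O) ∣ c • ∑ g, (χ g⁻¹ : ℤ_[p]) • φ g y - y
    rw [h1, Algebra.smul_def]
    refine (Finset.dvd_sum fun g _ => ?_).mul_left _
    rw [Algebra.smul_def]
    exact (hy g).mul_left _
  · rintro ⟨m, rfl⟩
    exact ⟨m, rfl, fun g => by rw [m.2 g]; simp⟩

end Eigen

theorem PadicInt.finite_quotient_span_pow (p n : ℕ) [hp : Fact p.Prime] :
    Finite (ℤ_[p] ⧸ Ideal.span {(p : ℤ_[p]) ^ n}) := by
  have : NeZero (p ^ n) := ⟨pow_ne_zero n hp.out.ne_zero⟩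
  rw [← PadicInt.ker_toZModPow]
  exact Finite.of_injective _ (RingHom.kerLift_injective (PadicInt.toZModPow (p := p) n))

theorem finite_quotient_span_prime_pow {p : ℕ} [Fact p.Prime] (O : Type*) [CommRing O]
    [Algebra ℤ_[p] O] [Module.Finite ℤ_[p] O] (n : ℕ) : Finite (O ⧸ Ideal.span {(p : O) ^ n}) := by
  have := PadicInt.finite_quotient_span_pow p n
  have := Submodule.finite_quotient_smul (Ideal.span {(p : ℤ_[p]) ^ n})
    (N := (⊤ : Submodule ℤ_[p] O)) Module.Finite.fg_top
  refine Finite.of_surjective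
    (Submodule.liftQ (Ideal.span {(p : ℤ_[p]) ^ n} • (⊤ : Submodule ℤ_[p] O))
      (Ideal.Quotient.mkₐ ℤ_[p] (Ideal.span {(p : O) ^ n})).toLinearMap ?_) fun x => ?_
  swap
  · obtain ⟨y, rfl⟩ := Ideal.Quotient.mk_surjective x
    exact ⟨Submodule.Quotient.mk y, rfl⟩
  rw [Submodule.smul_le]
  intro r hr x _
  obtain ⟨c, rfl⟩ := Ideal.mem_span_singleton.1 hr
  rw [LinearMap.mem_ker, AlgHom.toLinearMap_apply, Ideal.Quotient.mkₐ_eq_mk,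
    Ideal.Quotient.eq_zero_iff_mem, Ideal.mem_span_singleton, Algebra.smul_def]
  simp [mul_assoc]

theorem isIntegral_iff_spectralNorm_le_one {p : ℕ} [Fact p.Prime] {K : Type*} [Field K]
    [Algebra ℚ_[p] K] [Algebra.IsAlgebraic ℚ_[p] K] [Algebra ℤ_[p] K]
    [IsScalarTower ℤ_[p] ℚ_[p] K] (x : K) :
    IsIntegral ℤ_[p] x ↔ spectralNorm ℚ_[p] K x ≤ 1 := by
  have hx : IsIntegral ℚ_[p] x := Algebra.IsIntegral.isIntegral x
  rw [spectralNorm, spectralValue_le_one_iff (minpoly.monic hx)]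
  constructor
  · intro h n
    rw [minpoly.isIntegrallyClosed_eq_field_fractions' ℚ_[p] h, Polynomial.coeff_map]
    exact PadicInt.norm_le_one _
  · intro h
    have hl : minpoly ℚ_[p] x ∈ Polynomial.lifts (algebraMap ℤ_[p] ℚ_[p]) := by
      rw [Polynomial.lifts_iff_coeff_lifts]
      exact fun n => ⟨⟨_, h n⟩, rfl⟩
    obtain ⟨q, hq, -, hqm⟩ := Polynomial.lifts_and_degree_eq_and_monic hl (minpoly.monic hx)
    refine ⟨q, hqm, ?_⟩
    rw [← Polynomial.aeval_def, ← Polynomial.aeval_map_algebraMap ℚ_[p], hq, minpoly.aeval]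

theorem exists_one_add_prime_mul_pow_eq {p : ℕ} (hp : p.Prime) (hodd : Odd p) {K : Type*}
    [NormedField K] [CompleteSpace K] (hpK : ‖(p : K)‖ < 1) (O : Subring K)
    (hO : ∀ x, x ∈ O ↔ ‖x‖ ≤ 1) (z : O) :
    ∃ y, (1 + p * y) ^ p = 1 + (p : O) ^ 2 * z := by
  obtain ⟨h, hh⟩ := exists_one_add_prime_mul_X_pow hp hodd
  have hclosed : IsClosed (O : Set K) := by
    have : (O : Set K) = {x | ‖x‖ ≤ 1} := Set.ext hO
    rw [this]
    exact isClosed_le continuous_norm continuous_const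
  have : CompleteSpace O := hclosed.completeSpace_coe
  let T : O → O := fun y => z - p * Polynomial.aeval y h
  have hT : ContractingWith ‖(p : K)‖₊ T := by
    refine ⟨hpK, LipschitzWith.of_dist_le_mul fun y y' => ?_⟩
    obtain ⟨c, hc⟩ := Polynomial.sub_dvd_eval_sub y y' (h.map (algebraMap ℤ O))
    simp only [← Polynomial.eval₂_eq_eval_map, ← Polynomial.aeval_def] at hc
    have h1 : T y - T y' = -(p * ((y - y') * c)) := by
      rw [← hc]
      simp only [T]
      ring
    have h2 : ‖(c : K)‖ ≤ 1 := (hO c).1 c.2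
    rw [Subtype.dist_eq, Subtype.dist_eq, dist_eq_norm, dist_eq_norm, ← AddSubgroupClass.coe_sub, h1]
    simp only [Subring.coe_neg, Subring.coe_mul, Subring.coe_natCast, AddSubgroupClass.coe_sub, norm_neg,
      norm_mul, coe_nnnorm]
    exact mul_le_mul_of_nonneg_left (mul_le_of_le_one_right (norm_nonneg _) h2) (norm_nonneg _)
  obtain ⟨y, hy, -⟩ := hT.exists_fixedPoint 0 (edist_ne_top _ _)
  refine ⟨y, ?_⟩
  have h1 := congrArg (Polynomial.aeval y) hh
  simp only [map_pow, map_add, map_mul, map_one, Polynomial.aeval_X, 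
    map_natCast] at h1
  rw [h1]
  nth_rewrite 1 [← hy]
  simp only [T]
  ring

theorem exists_eq_pow_of_eq_pow_mul_pow {p k : ℕ} (hp : p.Prime) (hk : ¬ k ≡ 1 [MOD p])
    {K M : Type*} [Field K] [GroupWithZero M] (S : K →*₀ M) {x x' y : K} (hx : x ≠ 0) (hy : y ≠ 0)
    (hS : S x' = S x) (h : x' = x ^ k * y ^ p) : ∃ z, z ≠ 0 ∧ S x = S z ^ p := by
  have hcop : IsCoprime ((k : ℤ) - 1) p := by
    rw [Int.isCoprime_iff_gcd_eq_one, Int.gcd_comm, ← Int.isCoprime_iff_gcd_eq_one,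
      (Nat.prime_iff_prime_int.1 hp).coprime_iff_not_dvd]
    intro h
    exact hk (Nat.modEq_iff_dvd.2 (by exact_mod_cast h)).symm
  obtain ⟨a, b, hab⟩ := hcop
  refine ⟨y ^ (-a) * x ^ b, mul_ne_zero (zpow_ne_zero _ hy) (zpow_ne_zero _ hx), ?_⟩
  have hSx : S x ≠ 0 := (map_ne_zero S).2 hx
  have hSy : S y ≠ 0 := (map_ne_zero S).2 hy
  have h1 : S x = S (x ^ ((k : ℤ) - 1) * y ^ p * x) := by
    rw [← hS, h, zpow_sub_one₀ hx, zpow_natCast]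
    congr 1
    field_simp
  have h2 : S (x ^ ((k : ℤ) - 1) * y ^ (p : ℤ)) = 1 := by
    rw [map_mul] at h1
    rw [zpow_natCast]
    exact (mul_eq_right₀ hSx).1 h1.symm
  rw [← map_pow]
  calc S x = S x * S (x ^ ((k : ℤ) - 1) * y ^ (p : ℤ)) ^ (-a) := by rw [h2]; simp
    _ = S (x * (x ^ ((k : ℤ) - 1) * y ^ (p : ℤ)) ^ (-a)) := by rw [map_mul S x, map_zpow₀]
    _ = S ((y ^ (-a) * x ^ b) ^ p) := by
      congr 1
      have hb : b * p = 1 + ((k : ℤ) - 1) * -a := by linear_combination hab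
      rw [mul_zpow, mul_pow, ← zpow_natCast (y ^ (-a)), ← zpow_natCast (x ^ b), ← zpow_mul,
        ← zpow_mul, ← zpow_mul, ← zpow_mul, hb, zpow_one_add₀ hx, mul_comm (p : ℤ) (-a)]
      ring

theorem finrank_eigenSubmodule_one {R k F K : Type*} [CommRing R] [IsDomain R]
    [IsPrincipalIdealRing R] [Field k] [Algebra R k] [IsFractionRing R k] [Field F] [Algebra k F]
    [FiniteDimensional k F] [Algebra.IsSeparable k F] [Algebra R F] [IsScalarTower R k F] [Field K]
    [Algebra F K] [FiniteDimensional F K] [IsGalois F K] [Algebra R K] [IsScalarTower R F K]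
    [Module.IsTorsionFree R F]
    (φ : (K ≃ₐ[F] K) →* (integralClosure R K →ₐ[R] integralClosure R K))
    (hφ : ∀ g x, (φ g x : K) = g x) :
    Module.finrank R (eigenSubmodule φ (1 : (K ≃ₐ[F] K) →* Rˣ)) = Module.finrank k F := by
  rw [← IsIntegralClosure.rank R k F (integralClosure R F)]
  let j := (IsScalarTower.toAlgHom R F K).mapIntegralClosure.toLinearMap.codRestrict
    (eigenSubmodule φ (1 : (K ≃ₐ[F] K) →* Rˣ)) fun x g => Subtype.ext (by simp [hφ])
  have hj : ∀ x, ((j x : integralClosure R K) : K) = algebraMap F K x := fun x => rfl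
  refine (LinearEquiv.finrank_eq (LinearEquiv.ofBijective j ⟨fun x y hxy => ?_, fun x => ?_⟩)).symm
  · have h := congrArg (fun x : eigenSubmodule φ 1 => ((x : integralClosure R K) : K)) hxy
    exact Subtype.ext ((algebraMap F K).injective h)
  · obtain ⟨y, hy⟩ := (IsGalois.mem_range_algebraMap_iff_fixed (F := F) (x.1 : K)).2 fun g => by
      rw [← hφ, x.2 g]
      simp
    refine ⟨⟨y, ?_⟩, Subtype.ext (Subtype.ext hy)⟩
    have := x.1.2
    rw [← hy] at this
    exact (isIntegral_algebraMap_iff (algebraMap F K).injective).1 this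

section Field

variable {p : ℕ} [hp : Fact p.Prime] {K : Type*} [Field K] [Algebra ℚ_[p] K]
  [FiniteDimensional ℚ_[p] K]

/-- The spectral norm, as a homomorphism of monoids with zero. -/
noncomputable def spectralNormHom (p : ℕ) [Fact p.Prime] (K : Type*) [Field K] [Algebra ℚ_[p] K]
    [FiniteDimensional ℚ_[p] K] : K →*₀ ℝ where
  toFun := spectralNorm ℚ_[p] K
  map_zero' := spectralNorm_zero
  map_one' := spectralNorm_one
  map_mul' := map_mul (spectralMulAlgNorm ℚ_[p] K)

theorem spectralNormHom_prime_lt_one : spectralNormHom p K p < 1 := by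
  have : spectralNormHom p K (algebraMap ℚ_[p] K p) = ‖(p : ℚ_[p])‖ := spectralNorm_extends _
  rw [map_natCast] at this
  rw [this]
  exact Padic.norm_p_lt_one

variable [Algebra ℤ_[p] K] [IsScalarTower ℤ_[p] ℚ_[p] K]

theorem mem_integralClosure_iff_spectralNormHom (x : K) :
    x ∈ integralClosure ℤ_[p] K ↔ spectralNormHom p K x ≤ 1 :=
  isIntegral_iff_spectralNorm_le_one x

theorem exists_unit_integralClosure_eq {x : K} (hx : spectralNormHom p K x = 1) :
    ∃ u : (integralClosure ℤ_[p] K)ˣ, (u : K) = x := by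
  have hx0 : x ≠ 0 := by
    rintro rfl
    simp at hx
  refine ⟨⟨⟨x, ?_⟩, ⟨x⁻¹, ?_⟩, ?_, ?_⟩, rfl⟩
  · rw [mem_integralClosure_iff_spectralNormHom, hx]
  · rw [mem_integralClosure_iff_spectralNormHom, map_inv₀, hx, inv_one]
  · exact Subtype.ext (mul_inv_cancel₀ hx0)
  · exact Subtype.ext (inv_mul_cancel₀ hx0)

theorem spectralNormHom_unit (u : (integralClosure ℤ_[p] K)ˣ) :
    spectralNormHom p K u = 1 := by
  refine le_antisymm ((mem_integralClosure_iff_spectralNormHom _).1 u.1.2) ?_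
  have h1 := (mem_integralClosure_iff_spectralNormHom _).1 (u⁻¹).1.2
  have h2 : spectralNormHom p K (u : integralClosure ℤ_[p] K) *
      spectralNormHom p K ((u⁻¹ : (integralClosure ℤ_[p] K)ˣ) : integralClosure ℤ_[p] K) = 1 := by
    rw [← map_mul, ← Subalgebra.coe_mul, Units.mul_inv]
    simp
  have h3 : 0 ≤ spectralNormHom p K (u : integralClosure ℤ_[p] K) := spectralNorm_nonneg _
  nlinarith

theorem isUnit_one_add_prime_mul (y : integralClosure ℤ_[p] K) :
    IsUnit (1 + (p : integralClosure ℤ_[p] K) * y) := by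
  have h1 : ∀ y : integralClosure ℤ_[p] K, spectralNormHom p K (p * y) < 1 := fun y => by
    rw [map_mul]
    have hy := (mem_integralClosure_iff_spectralNormHom _).1 y.2
    have h0 : 0 ≤ spectralNormHom p K p := spectralNorm_nonneg _
    have := spectralNormHom_prime_lt_one (p := p) (K := K)
    nlinarith
  have h2 : spectralNormHom p K (1 + p * y) = 1 := by
    refine le_antisymm ((mem_integralClosure_iff_spectralNormHom _).1 (1 + p * y).2) ?_
    by_contra! h
    have h3 : spectralNormHom p K ((1 + p * y : K) + p * -y) ≤ _ :=
      isNonarchimedean_spectralNorm (1 + p * y : K) (p * -y : K)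
    have h4 := h3.trans_lt (max_lt h (h1 (-y)))
    rw [mul_neg, add_neg_cancel_right, map_one] at h4
    exact h4.false
  obtain ⟨u, hu⟩ := exists_unit_integralClosure_eq h2
  exact ⟨u, Subtype.ext hu⟩

theorem exists_integralClosure_one_add_prime_mul_pow_eq (hodd : Odd p)
    (z : integralClosure ℤ_[p] K) :
    ∃ y, (1 + p * y) ^ p = 1 + (p : integralClosure ℤ_[p] K) ^ 2 * z := by
  let := spectralNorm.normedField ℚ_[p] K
  have : CompleteSpace K := spectralNorm.completeSpace ℚ_[p] K
  exact exists_one_add_prime_mul_pow_eq hp.out hodd (K := K) spectralNormHom_prime_lt_one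
    (integralClosure ℤ_[p] K).toSubring mem_integralClosure_iff_spectralNormHom z

end Field

theorem mem_omegaEigenspace_iff {p : ℕ} [hp : Fact p.Prime] {F K : Type*} [Field F] [Field K]
    [Algebra F K] [Algebra ℚ_[p] F] [Algebra ℚ_[p] K] [IsScalarTower ℚ_[p] F K]
    [FiniteDimensional ℚ_[p] K] [Algebra ℤ_[p] K] [IsScalarTower ℤ_[p] ℚ_[p] K]
    (ω : (K ≃ₐ[F] K) →* (ZMod p)ˣ) {σ : K ≃ₐ[F] K} (hσ : ω σ ≠ 1) (c : KmodP p K) :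
    c ∈ omegaEigenspace p F K ω ↔ ∃ u : (integralClosure ℤ_[p] K)ˣ,
      (QuotientGroup.mk (Units.map (integralClosure ℤ_[p] K).val u) : KmodP p K) = c ∧
      ∀ g : K ≃ₐ[F] K, ∃ v : (integralClosure ℤ_[p] K)ˣ,
        g u = (u : K) ^ (ω g : ZMod p).val * (v : K) ^ p := by
  have hS : ∀ (g : K ≃ₐ[F] K) x, spectralNormHom p K (g x) = spectralNormHom p K x := fun g x =>
    (spectralNorm_eq_of_equiv (g.restrictScalars ℚ_[p]) x).symm
  constructor
  · rintro ⟨x, rfl, hx⟩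
    obtain ⟨y, hy, hxy⟩ := hx σ
    have hk : ¬ (ω σ : ZMod p).val ≡ 1 [MOD p] := by
      rw [← ZMod.natCast_eq_natCast_iff]
      simpa using hσ
    obtain ⟨z, hz, hxz⟩ := exists_eq_pow_of_eq_pow_mul_pow hp.out hk (spectralNormHom p K)
      x.ne_zero hy (hS σ x) hxy
    obtain ⟨u, hu⟩ := exists_unit_integralClosure_eq (p := p) (x := (x : K) / z ^ p) (by
      rw [map_div₀, map_pow, hxz, div_self (pow_ne_zero _ ((map_ne_zero _).2 hz))])
    have hux : (x : K) = u * z ^ p := by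
      rw [hu, div_mul_cancel₀ _ (pow_ne_zero _ hz)]
    refine ⟨u, ?_, fun g => ?_⟩
    · rw [QuotientGroup.eq]
      refine ⟨Units.mk0 z hz, ?_⟩
      rw [powMonoidHom_apply, eq_inv_mul_iff_mul_eq]
      exact Units.ext hux.symm
    · obtain ⟨y, hy, hgy⟩ := hx g
      rw [hux, map_mul, map_pow] at hgy
      have hgz : g z ≠ 0 := (map_ne_zero g).2 hz
      have hguv : g u = (u : K) ^ (ω g : ZMod p).val *
          (z ^ (ω g : ZMod p).val * y / g z) ^ p := by
        rw [div_pow, mul_div_assoc', eq_div_iff (pow_ne_zero _ hgz), hgy]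
        ring
      obtain ⟨v, hv⟩ := exists_unit_integralClosure_eq (p := p)
          (x := z ^ (ω g : ZMod p).val * y / g z) (by
        have h1 := congrArg (spectralNormHom p K) hguv
        rw [hS, map_mul, map_pow, map_pow, spectralNormHom_unit, one_pow, one_mul] at h1
        exact (pow_eq_one_iff_of_nonneg (spectralNorm_nonneg _) hp.out.ne_zero).1 h1.symm)
      exact ⟨v, by rw [hguv, hv]⟩
  · rintro ⟨u, rfl, hu⟩
    refine ⟨_, rfl, fun g => ?_⟩
    obtain ⟨v, hv⟩ := hu g
    exact ⟨v, by simp, hv⟩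

theorem natCard_omegaEigenspace_eq {p : ℕ} [hp : Fact p.Prime] (hodd : Odd p) {F K : Type*}
    [Field F] [Field K] [Algebra F K] [Algebra ℚ_[p] F] [FiniteDimensional ℚ_[p] F]
    [FiniteDimensional F K] [IsGalois F K] {ζ : K} (hζ : IsPrimitiveRoot ζ p)
    (ω : (K ≃ₐ[F] K) →* (ZMod p)ˣ) (hω : ∀ σ, σ ζ = ζ ^ (ω σ : ZMod p).val)
    (hinj : Function.Injective ω) {σ : K ≃ₐ[F] K} (hσ : ω σ ≠ 1) :
    Nat.card (omegaEigenspace p F K ω) = p ^ (1 + Module.finrank ℚ_[p] F) := by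
  let : Algebra ℚ_[p] K := ((algebraMap F K).comp (algebraMap ℚ_[p] F)).toAlgebra
  have : IsScalarTower ℚ_[p] F K := .of_algebraMap_eq fun _ => rfl
  have : FiniteDimensional ℚ_[p] K := Module.Finite.trans F K
  let : Algebra ℤ_[p] F := ((algebraMap ℚ_[p] F).comp (algebraMap ℤ_[p] ℚ_[p])).toAlgebra
  let : Algebra ℤ_[p] K := ((algebraMap ℚ_[p] K).comp (algebraMap ℤ_[p] ℚ_[p])).toAlgebra
  have : IsScalarTower ℤ_[p] ℚ_[p] F := .of_algebraMap_eq fun _ => rfl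
  have : IsScalarTower ℤ_[p] ℚ_[p] K := .of_algebraMap_eq fun _ => rfl
  have : IsScalarTower ℤ_[p] F K := .of_algebraMap_eq fun _ => rfl
  have : CharZero F := charZero_of_injective_algebraMap (algebraMap ℚ_[p] F).injective
  have : CharZero K := charZero_of_injective_algebraMap (algebraMap F K).injective
  have : FaithfulSMul ℤ_[p] F := (faithfulSMul_iff_algebraMap_injective _ _).2
    ((algebraMap ℚ_[p] F).injective.comp (FaithfulSMul.algebraMap_injective ℤ_[p] ℚ_[p]))
  have : FaithfulSMul ℤ_[p] K := (faithfulSMul_iff_algebraMap_injective _ _).2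
    ((algebraMap ℚ_[p] K).injective.comp (FaithfulSMul.algebraMap_injective ℤ_[p] ℚ_[p]))
  set O := integralClosure ℤ_[p] K with hO
  have : Module.Finite ℤ_[p] O := IsIntegralClosure.finite ℤ_[p] ℚ_[p] K O
  have := finite_quotient_span_prime_pow (p := p) O 2
  have hp0 : (p : O) ≠ 0 := by
    intro h
    have := congrArg (fun x : O => (x : K)) h
    simp [hp.out.ne_zero] at this
  let φ : (K ≃ₐ[F] K) →* (O →ₐ[ℤ_[p]] O) :=
    { toFun := fun g => ((g : K →ₐ[F] K).restrictScalars ℤ_[p]).mapIntegralClosure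
      map_one' := rfl
      map_mul' := fun _ _ => rfl }
  have hφ : ∀ g x, (φ g x : K) = g x := fun _ _ => rfl
  let φ' : (K ≃ₐ[F] K) →* (O →+* O) :=
    { toFun := fun g => φ g
      map_one' := rfl
      map_mul' := fun _ _ => rfl }
  have hζO : IsIntegral ℤ_[p] ζ := hζ.isIntegral hp.out.pos |>.tower_top
  let z : O := ⟨ζ, hζO⟩
  have hz : IsPrimitiveRoot z p :=
    IsPrimitiveRoot.of_map_of_injective (f := O.val) hζ Subtype.val_injective
  have hφz : ∀ g, φ' g z = z ^ (ω g : ZMod p).val := fun g => Subtype.ext (hω g)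
  have hφinj : Function.Injective φ := fun g h hgh => hinj (Units.ext (ZMod.val_injective p (by
    refine hz.pow_inj (ZMod.val_lt _) (ZMod.val_lt _) ?_
    rw [← hφz, ← hφz]
    exact DFunLike.congr_fun hgh z)))
  have hG : (Nat.card (K ≃ₐ[F] K)).Coprime p := by
    have h1 : Nat.card (K ≃ₐ[F] K) ∣ p - 1 := by
      rw [← ZMod.card_units p, ← Nat.card_eq_fintype_card]
      exact Subgroup.card_dvd_of_injective ω hinj
    refine Nat.Coprime.coprime_dvd_left h1 ?_
    exact (Nat.coprime_self_sub_left hp.out.one_le).2 (by simp)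
  let f : Oˣ →* KmodP p K := (QuotientGroup.mk' _).comp (Units.map O.val)
  have hf : f.ker = (powMonoidHom p : Oˣ →* Oˣ).range := by
    ext u
    rw [MonoidHom.mem_ker]
    change (QuotientGroup.mk _ : KmodP p K) = 1 ↔ _
    rw [QuotientGroup.eq_one_iff]
    constructor
    · rintro ⟨x, hx⟩
      have hx' : (x : K) ^ p = u := congrArg Units.val hx
      obtain ⟨v, hv⟩ := exists_unit_integralClosure_eq (p := p) (x := (x : K)) (by
        have h1 := congrArg (spectralNormHom p K) hx'
        rw [map_pow, spectralNormHom_unit] at h1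
        exact (pow_eq_one_iff_of_nonneg (spectralNorm_nonneg _) hp.out.ne_zero).1 h1)
      refine ⟨v, Units.ext (Subtype.ext ?_)⟩
      rw [← hx', ← hv]
      rfl
    · rintro ⟨v, rfl⟩
      exact ⟨Units.map O.val v, rfl⟩
  have h1 := natCard_eigen_units_eq (O := O) (C := KmodP p K) hodd hp0 isUnit_one_add_prime_mul
    (exists_integralClosure_one_add_prime_mul_pow_eq hodd) hz hG φ' ω hφz f hf
  have h2 := natCard_eigen_quotient_prime_eq hG hφinj ω
  rw [finrank_eigenSubmodule_one (k := ℚ_[p]) φ hφ] at h2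
  rw [pow_add, pow_one, ← h2]
  refine Eq.trans (Nat.card_congr (Equiv.subtypeEquivRight fun c => ?_)) h1
  rw [mem_omegaEigenspace_iff ω hσ]
  refine exists_congr fun u => and_congr Iff.rfl (forall_congr' fun g => exists_congr fun v => ?_)
  rw [Subtype.ext_iff]
  rfl

/-- The `𝔽_p`-dimension of `V` equals `1 + ef = 1 + [F : ℚ_p]`; equivalently, since `V` is
an elementary abelian `p`-group, `Card V = p^(1+ef)`. -/
theorem statement12 (p : ℕ) [hp : Fact p.Prime] (hodd : Odd p)
    (F : Type*) [Field F] [Algebra ℚ_[p] F] [FiniteDimensional ℚ_[p] F]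
    (hreg : ¬ ∃ z : F, IsPrimitiveRoot z p)
    (K : Type*) [Field K] [Algebra F K]
    (ζ : K) (hζ : IsPrimitiveRoot ζ p)
    (hKgen : IntermediateField.adjoin F {ζ} = ⊤)
    (ω : (K ≃ₐ[F] K) → (ZMod p)ˣ)
    (hω : ∀ σ : K ≃ₐ[F] K, σ ζ = ζ ^ (ω σ : ZMod p).val)
    (w : K → ℤ) (hw0 : w 0 = 0)
    (hwmul : ∀ x y : K, x ≠ 0 → y ≠ 0 → w (x * y) = w x + w y)
    (hwadd : ∀ x y : K, x ≠ 0 → y ≠ 0 → x + y ≠ 0 → min (w x) (w y) ≤ w (x + y))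
    (hwsurj : ∃ π : K, π ≠ 0 ∧ w π = 1)
    (s : ℕ) (hs : 0 < s)
    (hsdvd : ∀ z : F, z ≠ 0 → (s : ℤ) ∣ w (algebraMap F K z))
    (hsval : ∃ z : F, z ≠ 0 ∧ w (algebraMap F K z) = (s : ℤ))
    (e : ℕ) (he : 0 < e) (hew : w (algebraMap F K (p : F)) = (e * s : ℕ))
    (f : ℕ) (hf : 0 < f) (hef : e * f = Module.finrank ℚ_[p] F)
    (e1s : ℕ) (he1s : (p - 1) * e1s = e * s)
    :
    Nat.card ↥(omegaEigenspace p F K ω) = p ^ (1 + e * f) := by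
  have : NeZero p := ⟨hp.out.ne_zero⟩
  have hζint : IsIntegral F ζ := hζ.isIntegral hp.out.pos |>.tower_top
  have hKalg : Algebra.adjoin F {ζ} = ⊤ := by
    rw [← IntermediateField.adjoin_simple_toSubalgebra_of_isAlgebraic hζint.isAlgebraic, hKgen,
      IntermediateField.top_toSubalgebra]
  have : IsCyclotomicExtension {p} F K := by
    refine (IsCyclotomicExtension.iff_singleton p F K).2 ⟨⟨ζ, hζ⟩, fun x => ?_⟩
    have hx : x ∈ Algebra.adjoin F {ζ} := by rw [hKalg]; exact Algebra.mem_top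
    have hsub : {ζ} ⊆ {b : K | b ^ p = 1} := Set.singleton_subset_iff.2 hζ.pow_eq_one
    exact Algebra.adjoin_mono hsub hx
  have : IsGalois F K := IsCyclotomicExtension.isGalois {p} F K
  have : FiniteDimensional F K := IsCyclotomicExtension.finiteDimensional {p} F K
  have hζval : ∀ {a b : (ZMod p)ˣ}, ζ ^ (a : ZMod p).val = ζ ^ (b : ZMod p).val → a = b :=
    fun h => Units.ext (ZMod.val_injective p (hζ.pow_inj (ZMod.val_lt _) (ZMod.val_lt _) h))
  let ω' : (K ≃ₐ[F] K) →* (ZMod p)ˣ := MonoidHom.mk' ω fun σ τ => hζval (by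
    rw [← hω, AlgEquiv.mul_apply, hω, map_pow, hω, ← pow_mul, Units.val_mul, ZMod.val_mul]
    exact pow_eq_pow_mod _ hζ.pow_eq_one)
  have hinj : Function.Injective ω' := fun σ τ h => by
    have h1 : (σ : K →ₐ[F] K) = τ := AlgHom.ext_of_adjoin_eq_top hKalg fun x hx => by
      rw [Set.mem_singleton_iff] at hx
      subst hx
      change σ x = τ x
      have h2 : ω σ = ω τ := h
      rw [hω, hω, h2]
    exact AlgEquiv.ext fun x => DFunLike.congr_fun h1 x
  obtain ⟨σ, hσ⟩ : ∃ σ, ω' σ ≠ 1 := by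
    by_contra! h
    have h1 : ∀ σ : K ≃ₐ[F] K, σ ζ = ζ := fun σ => by
      have h2 : ω σ = 1 := h σ
      rw [hω, h2, Units.val_one, ZMod.val_one, pow_one]
    obtain ⟨z, hz⟩ := (IsGalois.mem_range_algebraMap_iff_fixed ζ).2 h1
    exact hreg ⟨z, .of_map_of_injective (by rwa [hz]) (algebraMap F K).injective⟩
  rw [hef]
  exact natCard_omegaEigenspace_eq hodd hζ ω' hω hinj hσ
end

section
/- Let p be an odd prime, F a finite extension of ℚ_p with ramification index e over ℚ_p that does not contain a primitive p-th root of unity ζ, and K = F(ζ), of degree m = [K:F]. Then the ramification index of K|F equals the smallest positive integer s such that p−1 divides es, and the residual degree of K|F equals m/s. -/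
open IntermediateField

/-- A complete set of representatives of the residue field of a discretely valued field
`(F, v)`: a finite set of integral elements such that every integral element is congruent
modulo the maximal ideal to exactly one of them. -/
def IsResidueSystem {F : Type*} [Field F] (v : F → ℤ) (S : Finset F) : Prop :=
  (∀ x ∈ S, x = 0 ∨ 0 ≤ v x) ∧
    ∀ x : F, (x = 0 ∨ 0 ≤ v x) → ∃! s : F, s ∈ S ∧ (x - s = 0 ∨ 1 ≤ v (x - s))

/-- The laws of a normalised discrete valuation `w`, imposed on nonzero elements only. -/
structure IsDiscreteVal {K : Type*} [Field K] (w : K → ℤ) : Prop where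
  map_mul : ∀ x y : K, x ≠ 0 → y ≠ 0 → w (x * y) = w x + w y
  map_add : ∀ x y : K, x ≠ 0 → y ≠ 0 → x + y ≠ 0 → min (w x) (w y) ≤ w (x + y)
  surj : ∃ π : K, π ≠ 0 ∧ w π = 1

namespace IsDiscreteVal

variable {K : Type*} [Field K] {w : K → ℤ}

open Classical in
/-- The absolute value `x ↦ c ^ (-w x)` attached to a discrete valuation `w` and `c > 1`. -/
noncomputable def abs (hw : IsDiscreteVal w) (c : ℝ) (hc : 1 < c) : AbsoluteValue K ℝ where
  toFun x := if x = 0 then 0 else c ^ (-w x)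
  map_mul' x y := by
    by_cases hx : x = 0
    · simp [hx]
    by_cases hy : y = 0
    · simp [hy]
    have hc0 : c ≠ 0 := by positivity
    simp only [hx, hy, mul_eq_zero, or_self, if_false]
    rw [hw.map_mul x y hx hy, neg_add, zpow_add₀ hc0]
  nonneg' x := by
    have hc0 : 0 < c := by positivity
    split_ifs
    · exact le_rfl
    · positivity
  eq_zero' x := by
    have hc0 : c ≠ 0 := by positivity
    by_cases hx : x = 0
    · simp [hx]
    · simp [hx, zpow_ne_zero _ hc0]
  add_le' x y := by
    have hc0 : 0 < c := by positivity
    by_cases hx : x = 0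
    · simp [hx]
    by_cases hy : y = 0
    · simp [hy]
    by_cases hxy : x + y = 0
    · simp only [hx, hy, hxy, if_true, if_false]
      positivity
    simp only [hx, hy, hxy, if_false]
    rcases min_le_iff.1 (hw.map_add x y hx hy hxy) with h | h
    · have : c ^ (-w (x + y)) ≤ c ^ (-w x) := zpow_le_zpow_right₀ hc.le (by lia)
      have : 0 ≤ c ^ (-w y) := by positivity
      linarith
    · have : c ^ (-w (x + y)) ≤ c ^ (-w y) := zpow_le_zpow_right₀ hc.le (by lia)
      have : 0 ≤ c ^ (-w x) := by positivity
      linarith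

variable (hw : IsDiscreteVal w) {c : ℝ} (hc : 1 < c)

theorem abs_apply {x : K} (hx : x ≠ 0) : hw.abs c hc x = c ^ (-w x) :=
  if_neg hx

theorem isNonarchimedean_abs : IsNonarchimedean (hw.abs c hc) := by
  have hc0 : 0 < c := by positivity
  intro x y
  by_cases hx : x = 0
  · simp [hx]
  by_cases hy : y = 0
  · simp [hy]
  by_cases hxy : x + y = 0
  · simp [hxy]
  rw [abs_apply _ _ hx, abs_apply _ _ hy, abs_apply _ _ hxy, le_max_iff]
  rcases min_le_iff.1 (hw.map_add x y hx hy hxy) with h | h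
  · exact Or.inl (zpow_le_zpow_right₀ hc.le (by lia))
  · exact Or.inr (zpow_le_zpow_right₀ hc.le (by lia))

theorem abs_le_one_iff {x : K} : hw.abs c hc x ≤ 1 ↔ x = 0 ∨ 0 ≤ w x := by
  by_cases hx : x = 0
  · simp [hx]
  · rw [abs_apply _ _ hx, zpow_le_one_iff_right₀ hc]
    simp [hx]

theorem abs_lt_one_iff {x : K} : hw.abs c hc x < 1 ↔ x = 0 ∨ 1 ≤ w x := by
  by_cases hx : x = 0
  · simp [hx]
  · rw [abs_apply _ _ hx, zpow_lt_one_iff_right₀ hc]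
    simp only [hx, false_or]
    lia

end IsDiscreteVal

/-- An `n`-th root of a principal unit of `ℚ_[p]` exists for `n` prime to `p`. -/
theorem Padic.exists_pow_eq_of_norm_sub_one_lt {p : ℕ} [hp : Fact p.Prime] {n : ℕ}
    (hn : ¬ p ∣ n) {u : ℚ_[p]} (hu : ‖u - 1‖ < 1) : ∃ y : ℚ_[p], y ^ n = u := by
  have hu1 : ‖u‖ ≤ 1 := by
    have h := Padic.nonarchimedean (u - 1) 1
    rw [sub_add_cancel] at h
    exact h.trans (by simp [hu.le])
  let U : ℤ_[p] := ⟨u, hu1⟩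
  have hU : ‖U - 1‖ < 1 := by
    rw [PadicInt.norm_def]; exact hu
  have hn1 : ‖(n : ℤ_[p])‖ = 1 := by
    rw [PadicInt.norm_natCast_eq_one_iff]
    exact (Nat.Prime.coprime_iff_not_dvd hp.out).2 hn
  obtain ⟨z, hz, -⟩ := hensels_lemma (F := (Polynomial.X ^ n - Polynomial.C U : Polynomial ℤ_[p]))
    (a := (1 : ℤ_[p])) (by simpa [hn1, norm_sub_rev, Polynomial.derivative_X_pow] using hU)
  refine ⟨z, ?_⟩
  have hz' : z ^ n = U := by simpa [sub_eq_zero] using hz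
  have := congrArg (fun x : ℤ_[p] => (x : ℚ_[p])) hz'
  simpa [U] using this

/-- An integer whose `m`-th power is `1` modulo `p`, for `m` prime to `p`, lifts to an `m`-th
root of unity of `ℤ_[p]`. -/
theorem PadicInt.exists_pow_eq_one_norm_sub_lt {p : ℕ} [hp : Fact p.Prime] {m g : ℕ}
    (hm : ¬ p ∣ m) (hg : ¬ p ∣ g) (hgm : ((g : ZMod p)) ^ m = 1) :
    ∃ t : ℤ_[p], t ^ m = 1 ∧ ‖t - g‖ < 1 := by
  have hm1 : ‖(m : ℤ_[p])‖ = 1 := by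
    rw [PadicInt.norm_natCast_eq_one_iff]
    exact (Nat.Prime.coprime_iff_not_dvd hp.out).2 hm
  have hg1 : ‖(g : ℤ_[p])‖ = 1 := by
    rw [PadicInt.norm_natCast_eq_one_iff]
    exact (Nat.Prime.coprime_iff_not_dvd hp.out).2 hg
  have hlt : ‖(g : ℤ_[p]) ^ m - 1‖ < 1 := by
    have h : (p : ℤ) ∣ (g : ℤ) ^ m - 1 := by
      rw [← ZMod.intCast_zmod_eq_zero_iff_dvd]
      push_cast
      rw [hgm, sub_self]
    have := (PadicInt.norm_intCast_lt_one_iff (p := p) (z := (g : ℤ) ^ m - 1)).2 h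
    simpa using this
  obtain ⟨z, hz, hz1, -⟩ := hensels_lemma (F := (Polynomial.X ^ m - 1 : Polynomial ℤ_[p]))
    (a := (g : ℤ_[p])) (by simpa [hm1, hg1, Polynomial.derivative_X_pow] using hlt)
  refine ⟨z, by simpa [sub_eq_zero] using hz, ?_⟩
  simpa [hm1, hg1, Polynomial.derivative_X_pow] using hz1

theorem natCast_prime_ne_zero {p : ℕ} [hp : Fact p.Prime] {K : Type*} [Field K]
    [Algebra ℚ_[p] K] : (p : K) ≠ 0 := by
  rw [← map_natCast (algebraMap ℚ_[p] K) p, map_ne_zero]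
  exact_mod_cast hp.out.ne_zero

namespace IsDiscreteVal

variable {p : ℕ} [hp : Fact p.Prime] {K : Type*} [Field K] {w : K → ℤ}

theorem map_one (hw : IsDiscreteVal w) : w 1 = 0 := by
  have := hw.map_mul 1 1 one_ne_zero one_ne_zero
  rw [mul_one] at this
  lia

theorem map_pow (hw : IsDiscreteVal w) {x : K} (hx : x ≠ 0) (n : ℕ) : w (x ^ n) = n * w x := by
  induction n with
  | zero => simp [hw.map_one]
  | succ n ih =>
    rw [pow_succ, hw.map_mul _ _ (pow_ne_zero _ hx) hx, ih]
    push_cast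
    ring

theorem map_zpow (hw : IsDiscreteVal w) {x : K} (hx : x ≠ 0) (n : ℤ) : w (x ^ n) = n * w x := by
  have hnat := hw.map_pow hx
  cases n with
  | ofNat n => simpa using hnat n
  | negSucc n =>
    have h := hw.map_mul (x ^ (n + 1)) (x ^ (Int.negSucc n)) (pow_ne_zero _ hx)
      (zpow_ne_zero _ hx)
    rw [zpow_negSucc, mul_inv_cancel₀ (pow_ne_zero _ hx), hw.map_one, hnat] at h
    rw [zpow_negSucc, Int.negSucc_eq]
    push_cast at h ⊢
    linarith

/-- If `w x ≠ w y` then `w (x + y)` is the smaller of the two. -/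
theorem map_add_eq_of_lt (hw : IsDiscreteVal w) {x y : K} (hx : x ≠ 0) (hy : y ≠ 0)
    (h : w x < w y) : x + y ≠ 0 ∧ w (x + y) = w x := by
  have hna := hw.isNonarchimedean_abs (c := 2) (by norm_num)
  have hlt : hw.abs 2 (by norm_num) y < hw.abs 2 (by norm_num) x := by
    rw [abs_apply _ _ hx, abs_apply _ _ hy]
    exact zpow_lt_zpow_right₀ (by norm_num) (by lia)
  have heq := hna.add_eq_left_of_lt hlt
  have hne : x + y ≠ 0 := by
    rintro h0
    rw [h0, _root_.map_zero] at heq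
    exact hx ((AbsoluteValue.eq_zero _).1 heq.symm)
  refine ⟨hne, ?_⟩
  rw [abs_apply _ _ hx, abs_apply _ _ hne] at heq
  have := zpow_right_injective₀ (a := (2 : ℝ)) (by norm_num) (by norm_num) heq
  lia

variable [Algebra ℚ_[p] K]

theorem map_algebraMap_of_norm_sub_one_lt (hw : IsDiscreteVal w) {u : ℚ_[p]}
    (hu : ‖u - 1‖ < 1) : w (algebraMap ℚ_[p] K u) = 0 := by
  have hu0 : u ≠ 0 := by
    rintro rfl
    simp at hu
  set N := (w (algebraMap ℚ_[p] K u)).natAbs with hN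
  have hnd : ¬ p ∣ p * N + 1 := by
    rw [Nat.dvd_add_right (dvd_mul_right p N), Nat.dvd_one]
    exact hp.out.one_lt.ne'
  obtain ⟨y, hy⟩ := Padic.exists_pow_eq_of_norm_sub_one_lt hnd hu
  have hy0 : y ≠ 0 := by
    rintro rfl
    rw [zero_pow (by lia)] at hy
    exact hu0 hy.symm
  have h1 : w (algebraMap ℚ_[p] K u) = (p * N + 1 : ℕ) * w (algebraMap ℚ_[p] K y) := by
    rw [← hy, _root_.map_pow, hw.map_pow ((map_ne_zero _).2 hy0)]
  have h2 : (p * N + 1) ∣ N := by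
    rw [hN, ← Int.natCast_dvd]
    exact Dvd.intro _ h1.symm
  have h3 : N = 0 := by
    by_contra hne
    have h4 := Nat.le_of_dvd (Nat.pos_of_ne_zero hne) h2
    have : 1 * N ≤ p * N := Nat.mul_le_mul_right _ hp.out.one_lt.le
    lia
  exact Int.natAbs_eq_zero.1 h3

theorem map_prime_nonneg (hw : IsDiscreteVal w) : 0 ≤ w (p : K) := by
  by_contra! h
  have h1 := hw.map_algebraMap_of_norm_sub_one_lt (p := p) (u := p + 1)
    (by rw [add_sub_cancel_right]; exact Padic.norm_p_lt_one)
  rw [_root_.map_add, _root_.map_one, map_natCast] at h1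
  have := (hw.map_add_eq_of_lt (y := (1 : K)) (natCast_prime_ne_zero (p := p)) one_ne_zero
    (by rwa [hw.map_one])).2
  lia

theorem map_algebraMap_nonneg (hw : IsDiscreteVal w) {x : ℚ_[p]} (hx0 : x ≠ 0) (hx : ‖x‖ ≤ 1) :
    0 ≤ w (algebraMap ℚ_[p] K x) := by
  have hpK : (p : K) ≠ 0 := natCast_prime_ne_zero
  have hxK : algebraMap ℚ_[p] K x ≠ 0 := (map_ne_zero _).2 hx0
  by_contra! h
  set n := (w (p : K)).natAbs + 1 with hn
  have h1 := hw.map_algebraMap_of_norm_sub_one_lt (p := p) (u := p * x ^ n + 1) (by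
    rw [add_sub_cancel_right, norm_mul, norm_pow]
    have h2 : ‖(p : ℚ_[p])‖ < 1 := Padic.norm_p_lt_one
    have h3 : ‖x‖ ^ n ≤ 1 := pow_le_one₀ (norm_nonneg _) hx
    nlinarith [norm_nonneg (p : ℚ_[p]), norm_nonneg x])
  rw [_root_.map_add, _root_.map_one, _root_.map_mul, _root_.map_pow, map_natCast] at h1
  have hval : w ((p : K) * algebraMap ℚ_[p] K x ^ n) < 0 := by
    rw [hw.map_mul _ _ hpK (pow_ne_zero _ hxK), hw.map_pow hxK, hn]
    push_cast
    have := hw.map_prime_nonneg (p := p)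
    rw [abs_of_nonneg this]
    nlinarith
  have := (hw.map_add_eq_of_lt (y := (1 : K)) (mul_ne_zero hpK (pow_ne_zero _ hxK)) one_ne_zero
    (by rwa [hw.map_one])).2
  lia

theorem map_algebraMap (hw : IsDiscreteVal w) {x : ℚ_[p]} (hx : x ≠ 0) :
    w (algebraMap ℚ_[p] K x) = x.valuation * w (p : K) := by
  have hp0 : (p : ℚ_[p]) ≠ 0 := by exact_mod_cast hp.out.ne_zero
  have hunit : ∀ u : ℚ_[p], ‖u‖ = 1 → w (algebraMap ℚ_[p] K u) = 0 := by
    intro u hu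
    have hu0 : u ≠ 0 := by
      rintro rfl
      simp at hu
    have h1 := hw.map_algebraMap_nonneg hu0 hu.le
    have h2 := hw.map_algebraMap_nonneg (inv_ne_zero hu0) (by simp [hu])
    have h3 := hw.map_mul (algebraMap ℚ_[p] K u) (algebraMap ℚ_[p] K u⁻¹)
      ((map_ne_zero _).2 hu0) ((map_ne_zero _).2 (inv_ne_zero hu0))
    rw [← _root_.map_mul, mul_inv_cancel₀ hu0, _root_.map_one, hw.map_one] at h3
    lia
  have hdec : x = (x * (p : ℚ_[p]) ^ (-x.valuation)) * (p : ℚ_[p]) ^ x.valuation := by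
    rw [mul_assoc, ← zpow_add₀ hp0, neg_add_cancel, zpow_zero, mul_one]
  have hu : ‖x * (p : ℚ_[p]) ^ (-x.valuation)‖ = 1 := by
    rw [norm_mul, Padic.norm_eq_zpow_neg_valuation hx, Padic.norm_p_zpow, neg_neg,
      ← zpow_add₀ (by exact_mod_cast hp.out.ne_zero), neg_add_cancel, zpow_zero]
  conv_lhs => rw [hdec]
  rw [_root_.map_mul, hw.map_mul _ _ ((map_ne_zero _).2 (mul_ne_zero hx (zpow_ne_zero _ hp0)))
    ((map_ne_zero _).2 (zpow_ne_zero _ hp0)), hunit _ hu, zero_add, map_zpow₀,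
    map_natCast, hw.map_zpow natCast_prime_ne_zero]

/-- A discrete valuation of a finite extension of `ℚ_[p]` is positive at `p`. -/
theorem map_prime_pos (hw : IsDiscreteVal w) [FiniteDimensional ℚ_[p] K] :
    0 < w (p : K) := by
  refine lt_of_le_of_ne hw.map_prime_nonneg fun h0 => ?_
  set f := hw.abs 2 (by norm_num) with hf
  have hle : ∀ x : ℚ_[p], f (algebraMap ℚ_[p] K x) ≤ 1 := by
    intro x
    rw [hf, abs_le_one_iff]
    by_cases hx : x = 0
    · simp [hx]
    · right
      rw [hw.map_algebraMap hx, ← h0, mul_zero]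
  let b := Module.finBasis ℚ_[p] K
  have hbound : ∀ x : K, f x ≤ ∑ i, f (b i) := by
    intro x
    conv_lhs => rw [← b.sum_repr x]
    refine (AbsoluteValue.sum_le _ _ _).trans (Finset.sum_le_sum fun i _ => ?_)
    rw [Algebra.smul_def, _root_.map_mul]
    exact mul_le_of_le_one_left (AbsoluteValue.nonneg _ _) (hle _)
  obtain ⟨π, hπ0, hπ⟩ := hw.surj
  obtain ⟨n, hn⟩ := pow_unbounded_of_one_lt (∑ i, f (b i)) (one_lt_two (α := ℝ))
  have h1 := hbound (π ^ (-(n : ℤ)))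
  rw [hf, abs_apply _ _ (zpow_ne_zero _ hπ0), hw.map_zpow hπ0, hπ, ← hf] at h1
  simp only [mul_one, neg_neg, zpow_natCast] at h1
  linarith

/-- A discrete valuation of a finite extension `K` of `ℚ_[p]` induces the spectral norm. -/
theorem exists_abs_eq_spectralNorm (hw : IsDiscreteVal w) [FiniteDimensional ℚ_[p] K] :
    ∃ (c : ℝ) (hc : 1 < c), ∀ x : K, hw.abs c hc x = spectralNorm ℚ_[p] K x := by
  have hpos := hw.map_prime_pos (p := p)
  have hp1 : (1 : ℝ) < p := by exact_mod_cast hp.out.one_lt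
  obtain ⟨k, hk⟩ := Int.eq_ofNat_of_zero_le hpos.le
  have hk0 : k ≠ 0 := by
    rintro rfl
    simp [hk] at hpos
  have hck : ((p : ℝ) ^ ((k : ℝ)⁻¹)) ^ k = p := Real.rpow_inv_natCast_pow (by positivity) hk0
  have hc : 1 < (p : ℝ) ^ ((k : ℝ)⁻¹) := Real.one_lt_rpow hp1 (by positivity)
  refine ⟨_, hc, spectralNorm_unique_field_norm_ext fun x => ?_⟩
  by_cases hx : x = 0
  · simp [hx]
  rw [abs_apply _ _ ((map_ne_zero _).2 hx), hw.map_algebraMap hx, hk,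
    Padic.norm_eq_zpow_neg_valuation hx, mul_comm, neg_mul_eq_mul_neg, zpow_mul, zpow_natCast, hck]

end IsDiscreteVal

section Nonarchimedean

variable {K ι : Type*} [Field K] {N : AbsoluteValue K ℝ}

theorem IsNonarchimedean.map_sum_le (hN : IsNonarchimedean N) {s : Finset ι} {f : ι → K} {B : ℝ}
    (hB : 0 ≤ B) (h : ∀ i ∈ s, N (f i) ≤ B) : N (∑ i ∈ s, f i) ≤ B := by
  classical
  induction s using Finset.induction_on with
  | empty => simpa
  | insert a s ha ih =>
    rw [Finset.sum_insert ha]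
    exact (hN _ _).trans (max_le (h a (by simp)) (ih fun i hi => h i (by simp [hi])))

theorem IsNonarchimedean.map_sum_lt (hN : IsNonarchimedean N) {s : Finset ι} {f : ι → K} {B : ℝ}
    (hB : 0 < B) (h : ∀ i ∈ s, N (f i) < B) : N (∑ i ∈ s, f i) < B := by
  classical
  induction s using Finset.induction_on with
  | empty => simpa
  | insert a s ha ih =>
    rw [Finset.sum_insert ha]
    exact (hN _ _).trans_lt (max_lt (h a (by simp)) (ih fun i hi => h i (by simp [hi])))

theorem IsNonarchimedean.map_sub_lt (hN : IsNonarchimedean N) {x y z : K} {B : ℝ}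
    (hxy : N (x - y) < B) (hyz : N (y - z) < B) : N (x - z) < B := by
  rw [← sub_add_sub_cancel x y z]
  exact (hN _ _).trans_lt (max_lt hxy hyz)

theorem AbsoluteValue.eq_one_of_pow_eq_one {x : K} {n : ℕ} (hn : n ≠ 0) (hx : x ^ n = 1) :
    N x = 1 := by
  rw [← pow_eq_one_iff_of_nonneg (N.nonneg x) hn, ← map_pow, hx, map_one]

end Nonarchimedean

theorem geom_sum_eq_zero_of_pow_eq_one {K : Type*} [Field K] {z : K} {m : ℕ} (hz : z ^ m = 1)
    (hz1 : z ≠ 1) : ∑ k ∈ Finset.range m, z ^ k = 0 := by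
  rw [geom_sum_eq hz1, hz, sub_self, zero_div]

section Eigenspaces

variable {F K : Type*} [Field F] [Field K] [Algebra F K] (σ : K ≃ₐ[F] K) (m : ℕ) (t : F)

/-- The Lagrange resolvent of `x`: up to the factor `m`, the projection of `x` to the eigenspace
of `σ` for the eigenvalue `t ^ i`. -/
def lagrangeResolvent (i : ℕ) (x : K) : K :=
  ∑ k ∈ Finset.range m, (algebraMap F K t)⁻¹ ^ (i * k) * (σ ^ k) x

variable {σ m t}

theorem apply_lagrangeResolvent (hσ : σ ^ m = 1) (ht0 : t ≠ 0) (ht : t ^ m = 1) (i : ℕ) (x : K) :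
    σ (lagrangeResolvent σ m t i x) = algebraMap F K t ^ i * lagrangeResolvent σ m t i x := by
  have hτ : algebraMap F K t ≠ 0 := (map_ne_zero _).2 ht0
  have hτm : algebraMap F K t ^ m = 1 := by rw [← map_pow, ht, map_one]
  set h : ℕ → K := fun k => (algebraMap F K t)⁻¹ ^ (i * k) * (σ ^ k) x with hh
  have h0 : h m = h 0 := by
    simp only [hh, hσ, mul_zero, pow_zero, one_mul]
    rw [mul_comm i m, pow_mul, inv_pow, hτm, inv_one, one_pow, one_mul]
  have hshift : ∑ k ∈ Finset.range m, h (k + 1) = ∑ k ∈ Finset.range m, h k := by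
    have h1 := Finset.sum_range_succ h m
    rw [Finset.sum_range_succ', h0] at h1
    exact add_right_cancel h1
  calc σ (lagrangeResolvent σ m t i x)
      = ∑ k ∈ Finset.range m, algebraMap F K t ^ i * h (k + 1) := by
        rw [lagrangeResolvent, map_sum]
        refine Finset.sum_congr rfl fun k _ => ?_
        rw [map_mul, map_pow, map_inv₀, AlgEquiv.commutes, hh]
        dsimp only
        rw [pow_succ' σ, AlgEquiv.mul_apply, mul_add, mul_one, pow_add, inv_pow, inv_pow]
        field_simp
    _ = algebraMap F K t ^ i * lagrangeResolvent σ m t i x := by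
        rw [← Finset.mul_sum, hshift, lagrangeResolvent]

theorem sum_lagrangeResolvent (ht : IsPrimitiveRoot t m) (hm : m ≠ 0) (x : K) :
    ∑ i ∈ Finset.range m, lagrangeResolvent σ m t i x = m * x := by
  have hτ : IsPrimitiveRoot (algebraMap F K t)⁻¹ m :=
    (ht.map_of_injective (algebraMap F K).injective).inv
  simp only [lagrangeResolvent]
  rw [Finset.sum_comm, Finset.sum_eq_single_of_mem 0 (by simp; lia)]
  · simp
  · intro k hk hk0
    rw [← Finset.sum_mul]
    simp only [mul_comm _ k, pow_mul]
    rw [geom_sum_eq_zero_of_pow_eq_one, zero_mul]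
    · rw [← pow_mul, mul_comm, pow_mul, hτ.pow_eq_one, one_pow]
    · exact hτ.pow_ne_one_of_pos_of_lt hk0 (Finset.mem_range.1 hk)

theorem pow_apply_eigenvector {α : K} (hα : σ α = algebraMap F K t * α) (k : ℕ) :
    (σ ^ k) α = algebraMap F K t ^ k * α := by
  induction k with
  | zero => simp
  | succ k ih =>
    rw [pow_succ', AlgEquiv.mul_apply, ih, map_mul, map_pow, AlgEquiv.commutes, hα, pow_succ,
      mul_assoc]

theorem lagrangeResolvent_sum (ht : IsPrimitiveRoot t m) {α : K}
    (hα : σ α = algebraMap F K t * α) (c : ℕ → F) {i : ℕ} (hi : i < m) :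
    lagrangeResolvent σ m t i (∑ j ∈ Finset.range m, algebraMap F K (c j) * α ^ j) =
      m * (algebraMap F K (c i) * α ^ i) := by
  have hτ : IsPrimitiveRoot (algebraMap F K t) m := ht.map_of_injective (algebraMap F K).injective
  have hτ0 : algebraMap F K t ≠ 0 := hτ.ne_zero (by lia)
  set τ := algebraMap F K t with hτdef
  have hterm : ∀ j k, τ⁻¹ ^ (i * k) * (σ ^ k) (algebraMap F K (c j) * α ^ j) =
      (τ⁻¹ ^ i * τ ^ j) ^ k * (algebraMap F K (c j) * α ^ j) := by
    intro j k
    rw [map_mul, map_pow, AlgEquiv.commutes, pow_apply_eigenvector hα, ← hτdef]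
    ring
  simp only [lagrangeResolvent, map_sum, Finset.mul_sum, ← hτdef, hterm]
  rw [Finset.sum_comm, Finset.sum_eq_single_of_mem i (Finset.mem_range.2 hi)]
  · rw [← Finset.sum_mul, inv_pow, inv_mul_cancel₀ (pow_ne_zero _ hτ0)]
    simp
  · intro j hj hji
    rw [← Finset.sum_mul, geom_sum_eq_zero_of_pow_eq_one, zero_mul]
    · rw [mul_pow, ← pow_mul, ← pow_mul, mul_comm i, mul_comm j, pow_mul, pow_mul, inv_pow,
        hτ.pow_eq_one]
      simp
    · intro h
      rw [inv_pow, inv_mul_eq_one₀ (pow_ne_zero _ hτ0)] at h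
      exact hji (hτ.pow_inj (Finset.mem_range.1 hj) hi h.symm)

theorem map_lagrangeResolvent_le {N : AbsoluteValue K ℝ} (hN : IsNonarchimedean N)
    (hσN : ∀ x, N (σ x) = N x) (ht : t ^ m = 1) (i : ℕ) (x : K) :
    N (lagrangeResolvent σ m t i x) ≤ N x := by
  refine hN.map_sum_le (N.nonneg _) fun k hk => ?_
  have hm : m ≠ 0 := by
    have := Finset.mem_range.1 hk
    lia
  have hτ : N (algebraMap F K t) = 1 :=
    AbsoluteValue.eq_one_of_pow_eq_one hm (by rw [← map_pow, ht, map_one])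
  have hpow : N ((σ ^ k) x) = N x := by
    clear hk
    induction k with
    | zero => simp
    | succ k ih => rw [pow_succ', AlgEquiv.mul_apply, hσN, ih]
  rw [map_mul, map_pow, map_inv₀, hτ, hpow]
  simp

/-- If the fixed field of `σ` is `F`, then the powers of an eigenvector for a primitive `m`-th
root of unity span `K` over `F`. -/
theorem exists_eq_sum_eigenvector_pow (hσ : σ ^ m = 1) (hm : (m : K) ≠ 0)
    (ht : IsPrimitiveRoot t m) (hfix : ∀ x, σ x = x → ∃ y, algebraMap F K y = x) {α : K}
    (hα0 : α ≠ 0) (hα : σ α = algebraMap F K t * α) (x : K) :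
    ∃ c : ℕ → F, x = ∑ i ∈ Finset.range m, algebraMap F K (c i) * α ^ i := by
  have hm0 : m ≠ 0 := by
    rintro rfl
    simp at hm
  have ht0 : t ≠ 0 := ht.ne_zero hm0
  have hτ0 : algebraMap F K t ≠ 0 := (map_ne_zero _).2 ht0
  have hc : ∀ i, ∃ y, algebraMap F K y = lagrangeResolvent σ m t i x / (m * α ^ i) := by
    intro i
    apply hfix
    rw [map_div₀, map_mul, map_pow, map_natCast, apply_lagrangeResolvent hσ ht0 ht.pow_eq_one, hα,
      mul_pow, mul_left_comm, mul_div_mul_left _ _ (pow_ne_zero _ hτ0)]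
  choose c hc using hc
  refine ⟨c, ?_⟩
  apply mul_left_cancel₀ hm
  rw [← sum_lagrangeResolvent (σ := σ) ht hm0, Finset.mul_sum]
  refine Finset.sum_congr rfl fun i _ => ?_
  rw [hc]
  field_simp

theorem map_term_le_map_sum {N : AbsoluteValue K ℝ} (hN : IsNonarchimedean N)
    (hσN : ∀ x, N (σ x) = N x) (hm : N (m : K) = 1) (ht : IsPrimitiveRoot t m) {α : K}
    (hα : σ α = algebraMap F K t * α) (c : ℕ → F) {i : ℕ} (hi : i < m) :
    N (algebraMap F K (c i) * α ^ i) ≤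
      N (∑ j ∈ Finset.range m, algebraMap F K (c j) * α ^ j) := by
  have h := map_lagrangeResolvent_le hN hσN ht.pow_eq_one i
    (∑ j ∈ Finset.range m, algebraMap F K (c j) * α ^ j)
  rwa [lagrangeResolvent_sum ht hα c hi, map_mul, hm, one_mul] at h

end Eigenspaces

theorem Finset.sum_range_mul_ite_dvd {M : Type*} [AddCommMonoid M] {r : ℕ} (hr : 0 < r) (f : ℕ)
    (g : ℕ → M) :
    ∑ i ∈ Finset.range (r * f), (if r ∣ i then g (i / r) else 0) = ∑ j ∈ Finset.range f, g j := by
  rw [← Finset.sum_filter]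
  refine Finset.sum_nbij' (· / r) (r * ·) ?_ ?_ ?_ ?_ ?_
  · intro i hi
    simp only [Finset.mem_filter, Finset.mem_range] at hi ⊢
    exact Nat.div_lt_of_lt_mul hi.1
  · intro j hj
    simp only [Finset.mem_filter, Finset.mem_range] at hj ⊢
    exact ⟨Nat.mul_lt_mul_of_pos_left hj hr, dvd_mul_right _ _⟩
  · intro i hi
    exact Nat.mul_div_cancel' (Finset.mem_filter.1 hi).2
  · intro j _
    exact Nat.mul_div_cancel_left j hr
  · intro i _
    rfl

/-- Counting residues: if the powers of `β` reduce to a basis of the residue field of `K` over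
that of `F`, then complete residue systems have the expected sizes. -/
theorem card_residueSystem_eq_pow {F K : Type*} [Field F] [Field K] [Algebra F K]
    {N : AbsoluteValue K ℝ} (hN : IsNonarchimedean N) {S : Finset F} {T : Finset K}
    (hS : ∀ s ∈ S, N (algebraMap F K s) ≤ 1)
    (hS' : ∀ z : F, N (algebraMap F K z) ≤ 1 → ∃! s : F, s ∈ S ∧ N (algebraMap F K (z - s)) < 1)
    (hT : ∀ s ∈ T, N s ≤ 1)
    (hT' : ∀ z : K, N z ≤ 1 → ∃! s : K, s ∈ T ∧ N (z - s) < 1)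
    {f : ℕ} {β : K} (hβ : N β = 1)
    (hspan : ∀ x : K, N x ≤ 1 → ∃ b : Fin f → F, (∀ j, N (algebraMap F K (b j)) ≤ 1) ∧
      N (x - ∑ j, algebraMap F K (b j) * β ^ (j : ℕ)) < 1)
    (hind : ∀ (b : Fin f → F) (j), N (algebraMap F K (b j)) ≤
      N (∑ j, algebraMap F K (b j) * β ^ (j : ℕ))) :
    T.card = S.card ^ f := by
  classical
  have hβj : ∀ (z : F) (j : ℕ), N (algebraMap F K z * β ^ j) = N (algebraMap F K z) := by
    intro z j
    rw [map_mul, map_pow, hβ, one_pow, mul_one]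
  have hsub : ∀ b b' : Fin f → F, ∑ j, algebraMap F K (b j) * β ^ (j : ℕ) -
      ∑ j, algebraMap F K (b' j) * β ^ (j : ℕ) =
      ∑ j, algebraMap F K ((b - b') j) * β ^ (j : ℕ) := by
    intro b b'
    simp only [← Finset.sum_sub_distrib, Pi.sub_apply, map_sub, sub_mul]
  have hcard : S.card ^ f = (Fintype.piFinset fun _ : Fin f => S).card := by simp
  rw [hcard]
  apply le_antisymm
  · refine Finset.card_le_card_of_forall_subsingleton
      (fun (x : K) (b : Fin f → F) => N (x - ∑ j, algebraMap F K (b j) * β ^ (j : ℕ)) < 1) ?_ ?_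
    · intro x hx
      obtain ⟨b, hb, hxb⟩ := hspan x (hT x hx)
      choose s hs _ using fun j => hS' (b j) (hb j)
      refine ⟨s, Fintype.mem_piFinset.2 fun j => (hs j).1, hN.map_sub_lt hxb ?_⟩
      rw [hsub]
      refine hN.map_sum_lt one_pos fun j _ => ?_
      rw [hβj]
      exact (hs j).2
    · intro b _ x hx y hy
      refine (hT' x (hT x hx.1)).unique ⟨hx.1, by simp⟩ ⟨hy.1, hN.map_sub_lt hx.2 ?_⟩
      rw [AbsoluteValue.map_sub]
      exact hy.2
  · refine Finset.card_le_card_of_forall_subsingleton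
      (fun (b : Fin f → F) (x : K) => N (∑ j, algebraMap F K (b j) * β ^ (j : ℕ) - x) < 1) ?_ ?_
    · intro b hb
      refine (hT' _ (hN.map_sum_le zero_le_one fun j _ => ?_)).exists
      rw [hβj]
      exact hS _ (Fintype.mem_piFinset.1 hb j)
    · intro x _ b hb b' hb'
      have hlt : N (∑ j, algebraMap F K ((b - b') j) * β ^ (j : ℕ)) < 1 := by
        rw [← hsub]
        refine hN.map_sub_lt hb.2 ?_
        rw [AbsoluteValue.map_sub]
        exact hb'.2
      funext j
      have hbj := Fintype.mem_piFinset.1 hb.1 j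
      refine (hS' (b j) (hS _ hbj)).unique ⟨hbj, by simp⟩
        ⟨Fintype.mem_piFinset.1 hb'.1 j, (hind _ j).trans_lt hlt⟩

section TameEigenvector

variable {F K : Type*} [Field F] [Field K] [Algebra F K] {v : F → ℤ} {w : K → ℤ}
  {σ : K ≃ₐ[F] K} {m r : ℕ} {t : F} {α : K}

/-- Over a ramified cyclic extension generated by an eigenvector `α`, the valuation of `α` is
coprime to the ramification index. -/
theorem isCoprime_eigenvector (hw : IsDiscreteVal w) {c : ℝ} (hc : 1 < c)
    (hres : ∀ z : F, z ≠ 0 → w (algebraMap F K z) = r * v z)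
    (hσN : ∀ x, hw.abs c hc (σ x) = hw.abs c hc x) (hm : hw.abs c hc (m : K) = 1)
    (ht : IsPrimitiveRoot t m) (hσ : σ ^ m = 1)
    (hfix : ∀ x, σ x = x → ∃ y, algebraMap F K y = x)
    (hα0 : α ≠ 0) (hα : σ α = algebraMap F K t * α) :
    IsCoprime (r : ℤ) (w α) := by
  have hN := hw.isNonarchimedean_abs hc
  have hmK : (m : K) ≠ 0 := by
    rw [← AbsoluteValue.ne_zero_iff (hw.abs c hc), hm]
    exact one_ne_zero
  obtain ⟨x, hx0, hx⟩ := hw.surj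
  obtain ⟨b, hb⟩ := exists_eq_sum_eigenvector_pow hσ hmK ht hfix hα0 hα x
  have hex : ∃ i ∈ Finset.range m,
      hw.abs c hc x ≤ hw.abs c hc (algebraMap F K (b i) * α ^ i) := by
    by_contra! h
    have hlt := hN.map_sum_lt ((hw.abs c hc).pos hx0) h
    rw [← hb] at hlt
    exact lt_irrefl _ hlt
  obtain ⟨i, hi, hle⟩ := hex
  have hge := map_term_le_map_sum hN hσN hm ht hα b (Finset.mem_range.1 hi)
  rw [← hb] at hge
  have heq := le_antisymm hge hle
  have hb0 : b i ≠ 0 := by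
    intro h0
    rw [h0, map_zero, zero_mul, map_zero] at heq
    exact ((hw.abs c hc).pos hx0).ne heq
  have hbK : algebraMap F K (b i) ≠ 0 := (map_ne_zero _).2 hb0
  rw [hw.abs_apply hc (mul_ne_zero hbK (pow_ne_zero _ hα0)), hw.abs_apply hc hx0,
    hw.map_mul _ _ hbK (pow_ne_zero _ hα0), hw.map_pow hα0, hres _ hb0, hx] at heq
  have := zpow_right_injective₀ (by positivity) hc.ne' heq
  exact ⟨v (b i), i, by linarith⟩

theorem dvd_of_eigenvector (hw : IsDiscreteVal w)
    (hres : ∀ z : F, z ≠ 0 → w (algebraMap F K z) = r * v z)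
    (ht : IsPrimitiveRoot t m) (hfix : ∀ x, σ x = x → ∃ y, algebraMap F K y = x)
    (hα0 : α ≠ 0) (hα : σ α = algebraMap F K t * α) (hcop : IsCoprime (r : ℤ) (w α)) : r ∣ m := by
  obtain ⟨y, hy⟩ := hfix (α ^ m) (by
    rw [map_pow, hα, mul_pow, ← map_pow, ht.pow_eq_one, map_one, one_mul])
  have hy0 : y ≠ 0 := by
    rintro rfl
    rw [map_zero] at hy
    exact pow_ne_zero _ hα0 hy.symm
  have h := hres y hy0
  rw [hy, hw.map_pow hα0] at h
  exact Int.natCast_dvd_natCast.1 (hcop.dvd_of_dvd_mul_right ⟨_, h⟩)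

/-- Over a ramified cyclic extension of degree `m` generated by an eigenvector `α`, the residual
degree is `m / r`, where `r` is the ramification index. -/
theorem card_residueSystem_of_eigenvector (hv : IsDiscreteVal v) (hw : IsDiscreteVal w) {c : ℝ}
    (hc : 1 < c) (hr : 0 < r) (hres : ∀ z : F, z ≠ 0 → w (algebraMap F K z) = r * v z)
    (hσN : ∀ x, hw.abs c hc (σ x) = hw.abs c hc x) (hm : hw.abs c hc (m : K) = 1)
    (ht : IsPrimitiveRoot t m) (hσ : σ ^ m = 1)
    (hfix : ∀ x, σ x = x → ∃ y, algebraMap F K y = x)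
    (hα0 : α ≠ 0) (hα : σ α = algebraMap F K t * α) {S : Finset F} {T : Finset K}
    (hS : IsResidueSystem v S) (hT : IsResidueSystem w T) : T.card = S.card ^ (m / r) := by
  set N := hw.abs c hc with hNdef
  have hN : IsNonarchimedean N := hw.isNonarchimedean_abs hc
  have hmK : (m : K) ≠ 0 := by
    rw [← AbsoluteValue.ne_zero_iff N, hm]
    exact one_ne_zero
  have hcop := isCoprime_eigenvector hw hc hres hσN hm ht hσ hfix hα0 hα
  obtain ⟨f, hf⟩ := dvd_of_eigenvector hw hres ht hfix hα0 hα hcop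
  rw [hf, Nat.mul_div_cancel_left _ hr]
  have hle : ∀ z : F, N (algebraMap F K z) ≤ 1 ↔ z = 0 ∨ 0 ≤ v z := by
    intro z
    rw [hNdef, hw.abs_le_one_iff, map_eq_zero]
    refine or_congr_right' fun hz => ?_
    rw [hres z hz, mul_nonneg_iff_of_pos_left (by exact_mod_cast hr)]
  have hlt : ∀ z : F, N (algebraMap F K z) < 1 ↔ z = 0 ∨ 1 ≤ v z := by
    intro z
    rw [hNdef, hw.abs_lt_one_iff, map_eq_zero]
    refine or_congr_right' fun hz => ?_
    have hone : ∀ n : ℤ, 1 ≤ n ↔ 0 < n := fun n => by lia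
    rw [hres z hz, hone, hone, mul_pos_iff_of_pos_left (by exact_mod_cast hr)]
  obtain ⟨π, hπ0, hπ⟩ := hv.surj
  have hπK : algebraMap F K π ≠ 0 := (map_ne_zero _).2 hπ0
  set β : K := α ^ r * algebraMap F K (π ^ (-w α)) with hβdef
  have hβ0 : β ≠ 0 :=
    mul_ne_zero (pow_ne_zero _ hα0) ((map_ne_zero _).2 (zpow_ne_zero _ hπ0))
  have hβ : N β = 1 := by
    rw [hNdef, hw.abs_apply hc hβ0, hβdef, hw.map_mul _ _ (pow_ne_zero _ hα0)
      ((map_ne_zero _).2 (zpow_ne_zero _ hπ0)), hres _ (zpow_ne_zero _ hπ0), hw.map_pow hα0,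
      hv.map_zpow hπ0, hπ]
    simp
  have hαβ : α ^ r = algebraMap F K (π ^ w α) * β := by
    rw [hβdef, mul_left_comm, ← map_mul, ← zpow_add₀ hπ0]
    simp
  have hNβ : ∀ (z : F) (j : ℕ), N (algebraMap F K z * β ^ j) = N (algebraMap F K z) := by
    intro z j
    rw [map_mul, map_pow, hβ, one_pow, mul_one]
  -- the coefficients with respect to the powers of `α` of a combination of powers of `β`
  let D : (ℕ → F) → ℕ → F := fun b i =>
    if r ∣ i then b (i / r) * (π ^ (-w α)) ^ (i / r) else 0
  have hDterm : ∀ b i, algebraMap F K (D b i) * α ^ i =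
      if r ∣ i then algebraMap F K (b (i / r)) * β ^ (i / r) else 0 := by
    intro b i
    simp only [D]
    split_ifs with h
    · obtain ⟨j, rfl⟩ := h
      rw [Nat.mul_div_cancel_left _ hr, hβdef, map_mul, map_pow, pow_mul]
      ring
    · simp
  have hDsum : ∀ b, ∑ i ∈ Finset.range m, algebraMap F K (D b i) * α ^ i =
      ∑ j ∈ Finset.range f, algebraMap F K (b j) * β ^ j := by
    intro b
    simp only [hDterm, hf]
    exact Finset.sum_range_mul_ite_dvd hr f fun j => algebraMap F K (b j) * β ^ j
  refine card_residueSystem_eq_pow hN (fun s hs => (hle s).2 (hS.1 s hs)) (fun z hz => ?_)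
    (fun s hs => (hw.abs_le_one_iff hc).2 (hT.1 s hs)) (fun z hz => ?_) hβ ?_ ?_
  · simp only [hlt]
    exact hS.2 z ((hle z).1 hz)
  · simp only [hNdef, hw.abs_lt_one_iff]
    exact hT.2 z ((hw.abs_le_one_iff hc).1 hz)
  · intro x hx
    obtain ⟨a, ha⟩ := exists_eq_sum_eigenvector_pow hσ hmK ht hfix hα0 hα x
    have hterm : ∀ i < m, N (algebraMap F K (a i) * α ^ i) ≤ 1 := by
      intro i hi
      have := map_term_le_map_sum hN hσN hm ht hα a hi
      rw [← ha] at this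
      exact this.trans hx
    let b : ℕ → F := fun j => a (r * j) * (π ^ w α) ^ j
    have hb : ∀ j, algebraMap F K (b j) * β ^ j = algebraMap F K (a (r * j)) * α ^ (r * j) := by
      intro j
      rw [pow_mul, hαβ, map_mul, map_pow]
      ring
    refine ⟨fun j => b j, fun j => ?_, ?_⟩
    · rw [← hNβ _ (j : ℕ), hb]
      apply hterm
      rw [hf]
      exact Nat.mul_lt_mul_of_pos_left j.2 hr
    · rw [Fin.sum_univ_eq_sum_range (fun j => algebraMap F K (b j) * β ^ j), ← hDsum b, ha,
        ← Finset.sum_sub_distrib]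
      refine hN.map_sum_lt one_pos fun i hi => ?_
      rw [hDterm]
      split_ifs with h
      · obtain ⟨j, rfl⟩ := h
        rw [Nat.mul_div_cancel_left _ hr, hb]
        simp
      · rw [sub_zero]
        refine lt_of_le_of_ne (hterm i (Finset.mem_range.1 hi)) fun h1 => h ?_
        have ha0 : a i ≠ 0 := by
          intro h0
          simp [h0] at h1
        have haK : algebraMap F K (a i) ≠ 0 := (map_ne_zero _).2 ha0
        rw [hNdef, hw.abs_apply hc (mul_ne_zero haK (pow_ne_zero _ hα0)),
          hw.map_mul _ _ haK (pow_ne_zero _ hα0), hw.map_pow hα0, hres _ ha0,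
          ← zpow_zero c] at h1
        have h2 := zpow_right_injective₀ (by positivity) hc.ne' h1
        have h3 : (r : ℤ) ∣ i * w α := ⟨-v (a i), by linarith⟩
        exact Int.natCast_dvd_natCast.1 (hcop.dvd_of_dvd_mul_right h3)
  · intro b j
    let b' : ℕ → F := fun j => if h : j < f then b ⟨j, h⟩ else 0
    have hb' : ∀ j : Fin f, b j = b' j := fun j => by simp [b']
    have hj : r * (j : ℕ) < m := by
      rw [hf]
      exact Nat.mul_lt_mul_of_pos_left j.2 hr
    have h := map_term_le_map_sum hN hσN hm ht hα (D b') hj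
    rw [hDsum, hDterm, if_pos (dvd_mul_right _ _), Nat.mul_div_cancel_left _ hr, hNβ,
      ← Fin.sum_univ_eq_sum_range (fun j => algebraMap F K (b' j) * β ^ j)] at h
    simpa only [hb'] using h

end TameEigenvector

section Cyclotomic

variable {K : Type*} [Field K] {N : AbsoluteValue K ℝ} {p : ℕ}

theorem map_one_sub_pow_le (hN : IsNonarchimedean N) {z : K} (hz : N z = 1) (k : ℕ) :
    N (1 - z ^ k) ≤ N (1 - z) := by
  rw [← mul_neg_geom_sum, map_mul]
  refine mul_le_of_le_one_right (N.nonneg _) (hN.map_sum_le zero_le_one fun i _ => ?_)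
  rw [map_pow, hz, one_pow]

theorem map_one_sub_pow_eq (hN : IsNonarchimedean N) [hp : Fact p.Prime] {ζ : K}
    (hζ : IsPrimitiveRoot ζ p) {k : ℕ} (hk : ¬ p ∣ k) : N (1 - ζ ^ k) = N (1 - ζ) := by
  have : NeZero p := ⟨hp.out.ne_zero⟩
  have hζk : IsPrimitiveRoot (ζ ^ k) p :=
    hζ.pow_of_coprime k ((Nat.Prime.coprime_iff_not_dvd hp.out).2 hk).symm
  refine le_antisymm
    (map_one_sub_pow_le hN (AbsoluteValue.eq_one_of_pow_eq_one hp.out.ne_zero hζ.pow_eq_one) k) ?_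
  obtain ⟨l, -, hl⟩ := hζk.eq_pow_of_pow_eq_one hζ.pow_eq_one
  conv_lhs => rw [← hl]
  exact map_one_sub_pow_le hN
    (AbsoluteValue.eq_one_of_pow_eq_one hp.out.ne_zero hζk.pow_eq_one) l

theorem map_one_sub_primitiveRoot_pow (hN : IsNonarchimedean N) [hp : Fact p.Prime] {ζ : K}
    (hζ : IsPrimitiveRoot ζ p) : N (1 - ζ) ^ (p - 1) = N p := by
  obtain ⟨n, rfl⟩ := Nat.exists_eq_add_one_of_ne_zero hp.out.ne_zero
  rw [Nat.cast_add_one, ← hζ.prod_one_sub_pow_eq_order, map_prod,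
    Finset.prod_congr rfl fun k hk => map_one_sub_pow_eq hN hζ ?_]
  · simp
  · intro h
    have := Nat.le_of_dvd (Nat.succ_pos _) h
    have := Finset.mem_range.1 hk
    lia

/-- The extension of `p`-adic fields generated by the `p`-th roots of unity is generated by an
eigenvector of an automorphism `σ`, with the same absolute value as `1 - ζ`. -/
theorem exists_eigenvector_of_isCyclotomicExtension [hp : Fact p.Prime] {F : Type*} [Field F]
    [Algebra ℚ_[p] F] [Algebra F K] [Algebra ℚ_[p] K] [IsScalarTower ℚ_[p] F K]
    [IsCyclotomicExtension {p} F K] (hN : IsNonarchimedean N)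
    (hNp : ∀ x : ℚ_[p], N (algebraMap ℚ_[p] K x) = ‖x‖)
    (hNσ : ∀ (σ : K ≃ₐ[F] K) (x : K), N (σ x) = N x) {ζ : K} (hζ : IsPrimitiveRoot ζ p) :
    ∃ (σ : K ≃ₐ[F] K) (t : F) (α : K), IsPrimitiveRoot t (Module.finrank F K) ∧
      σ ^ Module.finrank F K = 1 ∧ (∀ x, σ x = x → ∃ y, algebraMap F K y = x) ∧
      σ α = algebraMap F K t * α ∧ N α = N (1 - ζ) ∧
      N (Module.finrank F K : K) = 1 := by
  have : NeZero p := ⟨hp.out.ne_zero⟩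
  have : FiniteDimensional F K := IsCyclotomicExtension.finiteDimensional {p} F K
  have : IsGalois F K := IsCyclotomicExtension.isGalois {p} F K
  have hinj := hζ.autToPow_injective F
  have : IsCyclic (K ≃ₐ[F] K) := isCyclic_of_injective _ hinj
  obtain ⟨σ, hσ⟩ := IsCyclic.exists_generator (α := K ≃ₐ[F] K)
  set m := Module.finrank F K with hm
  have hord : orderOf σ = m := by
    rw [orderOf_eq_card_of_forall_mem_zpowers hσ, hm, IsGalois.card_aut_eq_finrank]
  have hm0 : m ≠ 0 := Module.finrank_pos.ne'
  have hσm : σ ^ m = 1 := hord ▸ pow_orderOf_eq_one σ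
  have hpm : ¬ p ∣ m := by
    intro h
    have h1 : m ∣ p - 1 := by
      rw [← ZMod.card_units p, ← hord, ← orderOf_injective _ hinj σ]
      exact orderOf_dvd_card
    have h2 := Nat.le_of_dvd (Nat.sub_pos_of_lt hp.out.one_lt) (h.trans h1)
    have := hp.out.pos
    lia
  have hNm : N (m : K) = 1 := by
    rw [← map_natCast (algebraMap ℚ_[p] K), hNp, Padic.norm_natCast_eq_one_iff]
    exact (Nat.Prime.coprime_iff_not_dvd hp.out).2 hpm
  set u := hζ.autToPow F σ with hu
  set g := (u : ZMod p).val with hg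
  have hgu : (g : ZMod p) = u := ZMod.natCast_zmod_val _
  have hζg : ζ ^ g = σ ζ := hζ.autToPow_spec F σ
  have hpg : ¬ p ∣ g := by
    rw [← ZMod.natCast_eq_zero_iff, hgu]
    exact u.ne_zero
  obtain ⟨t, htm, htg⟩ := PadicInt.exists_pow_eq_one_norm_sub_lt hpm hpg (by
    rw [hgu, ← Units.val_pow_eq_pow_val, hu, ← map_pow, hσm, map_one, Units.val_one])
  have htmod : PadicInt.toZMod t = u := by
    rw [← hgu, ← sub_eq_zero, ← map_natCast (PadicInt.toZMod (p := p)), ← map_sub,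
      ← RingHom.mem_ker, PadicInt.ker_toZMod, IsLocalRing.mem_maximalIdeal, PadicInt.mem_nonunits]
    exact htg
  have ht : IsPrimitiveRoot (algebraMap ℚ_[p] F t) m := by
    refine (IsPrimitiveRoot.mk_of_lt (t : ℚ_[p]) (Nat.pos_of_ne_zero hm0) ?_ ?_).map_of_injective
      (algebraMap ℚ_[p] F).injective
    · rw [← PadicInt.coe_pow, htm, PadicInt.coe_one]
    · intro l hl0 hlm htl
      have htl' : t ^ l = 1 := Subtype.ext (by rw [PadicInt.coe_pow, htl, PadicInt.coe_one])
      have h1 : u ^ l = 1 := by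
        ext
        rw [Units.val_pow_eq_pow_val, ← htmod, ← map_pow, htl', map_one, Units.val_one]
      rw [hu, ← map_pow] at h1
      have h2 : σ ^ l = 1 := hinj (h1.trans (map_one _).symm)
      have := Nat.le_of_dvd hl0 (orderOf_dvd_of_pow_eq_one h2)
      lia
  set τ := algebraMap F K (algebraMap ℚ_[p] F t) with hτ
  have hτm : τ ^ m = 1 := by rw [hτ, ← map_pow, ht.pow_eq_one, map_one]
  have hτ0 : τ ≠ 0 := by
    intro h
    rw [h, zero_pow hm0] at hτm
    exact zero_ne_one hτm
  have hNτ : N τ = 1 := AbsoluteValue.eq_one_of_pow_eq_one hm0 hτm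
  have hNζ : N ζ = 1 := AbsoluteValue.eq_one_of_pow_eq_one hp.out.ne_zero hζ.pow_eq_one
  set x := 1 - ζ with hx
  have hx0 : x ≠ 0 := sub_ne_zero.2 (hζ.ne_one hp.out.one_lt).symm
  have hNx : 0 < N x := N.pos hx0
  have hNx1 : N x < 1 := by
    have h1 := map_one_sub_primitiveRoot_pow hN hζ
    rw [← map_natCast (algebraMap ℚ_[p] K), hNp] at h1
    by_contra! h2
    have h3 := one_le_pow₀ (n := p - 1) h2
    rw [h1] at h3
    exact absurd Padic.norm_p_lt_one h3.not_gt
  have hNtg : N (g - τ) < 1 := by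
    have h1 : (g : K) - τ = algebraMap ℚ_[p] K (g - t) := by
      rw [map_sub, map_natCast, hτ, ← IsScalarTower.algebraMap_apply]
    rw [h1, hNp, norm_sub_rev]
    rw [PadicInt.norm_def] at htg
    simpa using htg
  have hbase : N (σ x - τ * x) < N x := by
    have h1 : σ x - τ * x = x * (∑ j ∈ Finset.range g, (ζ ^ j - 1) + (g - τ)) := by
      rw [hx, map_sub, map_one, ← hζg, ← mul_neg_geom_sum, Finset.sum_sub_distrib]
      simp
      ring
    rw [h1, map_mul]
    refine mul_lt_of_lt_one_right hNx ((hN _ _).trans_lt (max_lt ?_ hNtg))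
    refine hN.map_sum_lt one_pos fun j _ => ?_
    rw [AbsoluteValue.map_sub]
    exact (map_one_sub_pow_le hN hNζ j).trans_lt hNx1
  have hστ : σ τ = τ := σ.commutes _
  have hpow : ∀ k, N ((σ ^ k) x - τ ^ k * x) < N x := by
    intro k
    induction k with
    | zero => simpa using hNx
    | succ k ih =>
      have h1 : (σ ^ (k + 1)) x - τ ^ (k + 1) * x =
          σ ((σ ^ k) x - τ ^ k * x) + τ ^ k * (σ x - τ * x) := by
        rw [pow_succ' σ, AlgEquiv.mul_apply, map_sub σ ((σ ^ k) x), map_mul σ, map_pow σ, hστ]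
        ring
      rw [h1]
      refine (hN _ _).trans_lt (max_lt (by rwa [hNσ]) ?_)
      rwa [map_mul, map_pow, hNτ, one_pow, one_mul]
  refine ⟨σ, algebraMap ℚ_[p] F t, lagrangeResolvent σ m (algebraMap ℚ_[p] F t) 1 x, ht, hσm,
    fun y hy => ?_, ?_, ?_, hNm⟩
  · refine (IsGalois.mem_range_algebraMap_iff_fixed y).2 fun ρ => ?_
    have hle : Subgroup.zpowers σ ≤ MulAction.stabilizer (K ≃ₐ[F] K) y := by
      rw [Subgroup.zpowers_le]
      exact hy
    exact hle (hσ ρ)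
  · rw [apply_lagrangeResolvent hσm (ht.ne_zero hm0) ht.pow_eq_one, pow_one]
  · have h1 : lagrangeResolvent σ m (algebraMap ℚ_[p] F t) 1 x =
        m * x + ∑ k ∈ Finset.range m, (τ⁻¹ ^ k * ((σ ^ k) x - τ ^ k * x)) := by
      have h2 : ∀ k, τ⁻¹ ^ k * ((σ ^ k) x - τ ^ k * x) = τ⁻¹ ^ k * (σ ^ k) x - x := by
        intro k
        rw [mul_sub, ← mul_assoc, ← mul_pow, inv_mul_cancel₀ hτ0, one_pow, one_mul]
      simp only [h2, Finset.sum_sub_distrib, lagrangeResolvent, one_mul]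
      simp [hτ]
    rw [h1, hN.add_eq_left_of_lt]
    · rw [map_mul, hNm, one_mul]
    · rw [map_mul, hNm, one_mul]
      refine hN.map_sum_lt hNx fun k _ => ?_
      rw [map_mul, map_pow, map_inv₀, hNτ]
      simpa using hpow k

/-- The ramification index and residual degree of `F(ζ_p)` over a `p`-adic field `F`. -/
theorem cyclotomic_ramification [hp : Fact p.Prime] {F : Type*} [Field F]
    [Algebra ℚ_[p] F] [Algebra F K] [Algebra ℚ_[p] K] [IsScalarTower ℚ_[p] F K]
    [FiniteDimensional ℚ_[p] F] [IsCyclotomicExtension {p} F K] {ζ : K}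
    (hζ : IsPrimitiveRoot ζ p) {v : F → ℤ} (hv : IsDiscreteVal v) {w : K → ℤ}
    (hw : IsDiscreteVal w) {e : ℕ} (he : v p = e) :
    (∀ z : F, z ≠ 0 → w (algebraMap F K z) =
      (sInf {t : ℕ | 0 < t ∧ (p - 1) ∣ e * t} : ℕ) * v z) ∧
    ∀ (S : Finset F) (T : Finset K), IsResidueSystem v S → IsResidueSystem w T →
      T.card = S.card ^ (Module.finrank F K / sInf {t : ℕ | 0 < t ∧ (p - 1) ∣ e * t}) := by
  have : FiniteDimensional F K := IsCyclotomicExtension.finiteDimensional {p} F K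
  have : FiniteDimensional ℚ_[p] K := FiniteDimensional.trans ℚ_[p] F K
  obtain ⟨c, hc, hvc⟩ := hv.exists_abs_eq_spectralNorm (p := p)
  obtain ⟨d, hd, hwd⟩ := hw.exists_abs_eq_spectralNorm (p := p)
  have hd0 : 0 < d := one_pos.trans hd
  obtain ⟨π, hπ0, hπ⟩ := hv.surj
  have hcd : ∀ z : F, z ≠ 0 → d ^ (-w (algebraMap F K z)) = c ^ (-v z) := by
    intro z hz
    rw [← hw.abs_apply hd ((map_ne_zero _).2 hz), ← hv.abs_apply hc hz, hwd, hvc,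
      ← spectralNorm.eq_of_tower]
  have hc' : c = d ^ w (algebraMap F K π) := by
    have := hcd π hπ0
    rw [hπ, zpow_neg, zpow_neg, inv_inj, zpow_one] at this
    exact this.symm
  have hrpos : 0 < w (algebraMap F K π) := by
    rw [hc'] at hc
    exact (one_lt_zpow_iff_right₀ hd).1 hc
  obtain ⟨r, hr⟩ := Int.eq_ofNat_of_zero_le hrpos.le
  have hr0 : 0 < r := by lia
  have hres : ∀ z : F, z ≠ 0 → w (algebraMap F K z) = r * v z := by
    intro z hz
    have h := hcd z hz
    rw [hc', ← zpow_mul] at h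
    have := zpow_right_injective₀ hd0 hd.ne' h
    rw [hr] at this
    linarith
  have hN := hw.isNonarchimedean_abs hd
  have hNσ : ∀ (σ : K ≃ₐ[F] K) (x : K), hw.abs d hd (σ x) = hw.abs d hd x := by
    intro σ x
    rw [hwd, hwd, spectralNorm_eq_of_equiv (σ.restrictScalars ℚ_[p]) x]
    rfl
  obtain ⟨σ, t, α, ht, hσ, hfix, hα, hNα, hm⟩ := exists_eigenvector_of_isCyclotomicExtension
    (F := F) hN (fun x => by rw [hwd, spectralNorm_extends]) hNσ hζ
  have hx0 : 1 - ζ ≠ 0 := sub_ne_zero.2 (hζ.ne_one hp.out.one_lt).symm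
  have hα0 : α ≠ 0 := by
    rw [← AbsoluteValue.ne_zero_iff (hw.abs d hd), hNα]
    exact ((hw.abs d hd).pos hx0).ne'
  have hcop := isCoprime_eigenvector hw hd hres (hNσ σ) hm ht hσ hfix hα0 hα
  have hram : (p - 1 : ℕ) * w α = r * e := by
    have h := map_one_sub_primitiveRoot_pow hN hζ
    rw [← hNα, ← map_pow, hw.abs_apply hd (pow_ne_zero _ hα0),
      hw.abs_apply hd (natCast_prime_ne_zero (p := p)), hw.map_pow hα0] at h
    have h2 := zpow_right_injective₀ hd0 hd.ne' h
    have h3 := hres p (natCast_prime_ne_zero (p := p))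
    rw [map_natCast, he] at h3
    lia
  have hp1 : p - 1 ≠ 0 := (Nat.sub_pos_of_lt hp.out.one_lt).ne'
  have hs : sInf {t : ℕ | 0 < t ∧ (p - 1) ∣ e * t} = r := by
    refine IsLeast.csInf_eq ⟨⟨hr0, ?_⟩, ?_⟩
    · rw [← Int.natCast_dvd_natCast]
      exact ⟨w α, by push_cast; linarith⟩
    · rintro n ⟨hn0, k, hk⟩
      refine Nat.le_of_dvd hn0 (Int.natCast_dvd_natCast.1 (hcop.dvd_of_dvd_mul_right ⟨k, ?_⟩))
      have hk' : (e : ℤ) * n = (p - 1 : ℕ) * k := by exact_mod_cast hk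
      have hp1' : ((p - 1 : ℕ) : ℤ) ≠ 0 := by exact_mod_cast hp1
      apply mul_left_cancel₀ hp1'
      linear_combination n * hram + r * hk'
  rw [hs]
  exact ⟨hres, fun S T hS hT => card_residueSystem_of_eigenvector hv hw hd hr0 hres (hNσ σ) hm ht
    hσ hfix hα0 hα hS hT⟩

end Cyclotomic

/-- Let `p` be an odd prime, `F` a finite extension of `ℚ_p` with ramification index `e`
over `ℚ_p` not containing a primitive `p`-th root of unity `ζ`, and `K = F(ζ)`, of degree
`m = [K:F]`.  Then the ramification index of `K|F` equals the smallest positive integer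
`s` such that `p−1` divides `es` (i.e. `w` restricts on `F` to `s·v_F`), and the residual
degree of `K|F` equals `m/s` (i.e. the residue field of `K` has cardinality that of the
residue field of `F` raised to the power `m/s`). -/
theorem statement17 (p : ℕ) [hp : Fact p.Prime] (hodd : Odd p)
    (F : Type*) [Field F] [Algebra ℚ_[p] F] [FiniteDimensional ℚ_[p] F]
    (hreg : ¬ ∃ z : F, IsPrimitiveRoot z p)
    (Ω : Type*) [Field Ω] [Algebra F Ω] [IsAlgClosure F Ω]
    (ζ : Ω) (hζ : IsPrimitiveRoot ζ p)
    (vF : F → ℤ) (hv0 : vF 0 = 0)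
    (hvmul : ∀ x y : F, x ≠ 0 → y ≠ 0 → vF (x * y) = vF x + vF y)
    (hvadd : ∀ x y : F, x ≠ 0 → y ≠ 0 → x + y ≠ 0 → min (vF x) (vF y) ≤ vF (x + y))
    (hvsurj : ∃ π : F, π ≠ 0 ∧ vF π = 1)
    (e : ℕ) (he : 0 < e) (hev : vF ((p : F)) = (e : ℤ))
    (m : ℕ) (hm : m = Module.finrank F ↥(adjoin F {ζ}))
    (w : ↥(adjoin F {ζ}) → ℤ) (hw0 : w 0 = 0)
    (hwmul : ∀ x y : ↥(adjoin F {ζ}), x ≠ 0 → y ≠ 0 → w (x * y) = w x + w y)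
    (hwadd : ∀ x y : ↥(adjoin F {ζ}), x ≠ 0 → y ≠ 0 → x + y ≠ 0 →
      min (w x) (w y) ≤ w (x + y))
    (hwsurj : ∃ π : ↥(adjoin F {ζ}), π ≠ 0 ∧ w π = 1) :
    ∀ s : ℕ, s = sInf {t : ℕ | 0 < t ∧ (p - 1) ∣ e * t} →
      (∀ z : F, z ≠ 0 →
        w (algebraMap F ↥(adjoin F {ζ}) z) = (s : ℤ) * vF z) ∧
      ∀ (SF : Finset F) (SK : Finset ↥(adjoin F {ζ})),
        IsResidueSystem vF SF → IsResidueSystem w SK →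
          SK.card = SF.card ^ (m / s) := by
  have : NeZero p := ⟨hp.out.ne_zero⟩
  have hζint : IsIntegral F ζ := Algebra.IsIntegral.isIntegral ζ
  have : IsCyclotomicExtension {p} F ↥(adjoin F {ζ}) :=
    hζ.intermediateField_adjoin_isCyclotomicExtension F
  let : Algebra ℚ_[p] ↥(adjoin F {ζ}) :=
    ((algebraMap F ↥(adjoin F {ζ})).comp (algebraMap ℚ_[p] F)).toAlgebra
  have : IsScalarTower ℚ_[p] F ↥(adjoin F {ζ}) := IsScalarTower.of_algebraMap_eq fun _ => rfl
  have hζ' : IsPrimitiveRoot (AdjoinSimple.gen F ζ) p :=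
    IsPrimitiveRoot.of_map_of_injective (f := algebraMap ↥(adjoin F {ζ}) Ω)
      (by rwa [AdjoinSimple.algebraMap_gen]) (FaithfulSMul.algebraMap_injective _ _)
  rintro s rfl
  rw [hm]
  exact cyclotomic_ramification hζ' ⟨hvmul, hvadd, hvsurj⟩ ⟨hwmul, hwadd, hwsurj⟩ hev
end

section
/- Let k be a finite field with q = Card(k) elements, and let l|k be a field extension whose degree m = [l:k] divides q−1. For every group homomorphism χ : Gal(l|k) → k^×, the χ-eigenspace l(χ) = { x ∈ l : σ(x) = χ(σ)·x for all σ ∈ Gal(l|k) } is a k-subspace of l of dimension 1. -/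
/-- The `χ`-eigenspace `l(χ) = { x ∈ l : σ x = χ σ • x for all σ ∈ Gal(l|k) }`,
as a `k`-subspace of `l`. -/
def eigenspace18 (k l : Type*) [Field k] [Field l] [Algebra k l]
    (χ : (l ≃ₐ[k] l) →* kˣ) : Submodule k l where
  carrier := {x : l | ∀ σ : l ≃ₐ[k] l, σ x = algebraMap k l ((χ σ : kˣ) : k) * x}
  add_mem' := by
    intro a b ha hb σ
    simp [map_add, ha σ, hb σ, mul_add]
  zero_mem' := by
    intro σ
    simp
  smul_mem' := by
    intro c x hx σ
    simp only [Algebra.smul_def, map_mul, AlgEquiv.commutes, hx σ]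
    ring

/-- Let `k` be a finite field with `q = Card k` elements and `l|k` a field extension whose
degree `m = [l:k]` divides `q − 1`.  For every homomorphism `χ : Gal(l|k) → kˣ`, the
`χ`-eigenspace `l(χ)` is a `k`-subspace of `l` of dimension `1`. -/
theorem statement18 (k l : Type*) [Field k] [Field l] [Algebra k l]
    [Fintype k] [FiniteDimensional k l]
    (q : ℕ) (hq : q = Fintype.card k)
    (m : ℕ) (hm : m = Module.finrank k l) (hdvd : m ∣ q - 1)
    (χ : (l ≃ₐ[k] l) →* kˣ) :
    Module.finrank k ↥(eigenspace18 k l χ) = 1 := by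
  have : Finite l := Module.finite_of_finite k
  obtain ⟨β, hβ⟩ := groupCohomology.isMulCoboundary₁_of_isMulCocycle₁_of_aut_to_units
    (fun σ : l ≃ₐ[k] l => Units.map (algebraMap k l : k →* l) (χ σ)) (by
      intro σ τ
      ext
      simp [AlgEquiv.smul_units_def, mul_comm])
  have hβ_eigen (σ : l ≃ₐ[k] l) : σ (β : l) = algebraMap k l (χ σ) * β := by
    simpa [AlgEquiv.smul_units_def] using congrArg Units.val (div_eq_iff_eq_mul.mp (hβ σ))
  refine finrank_eq_one (⟨β, hβ_eigen⟩ : eigenspace18 k l χ)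
    (fun h => β.ne_zero (congrArg Subtype.val h)) ?_
  rintro ⟨w, hw⟩
  -- The quotient of two eigenvectors is Galois-invariant, hence a scalar.
  obtain ⟨c, hc⟩ := (IsGalois.mem_range_algebraMap_iff_fixed (F := k) (w / β)).mpr fun σ => by
    rw [map_div₀, hw σ, hβ_eigen σ, mul_div_mul_left _ _ (by simp)]
  refine ⟨c, Subtype.ext ?_⟩
  simp [Algebra.smul_def, hc]
end
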